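/- arXiv:2204.10637 — 3 statements merged into one kernel-verified Lean document; each statement's English description precedes it below -/
import Mathlib

section
/- Let k be a perfect field and k[z₁, …, z_d] → A an étale ring homomorphism from a polynomial ring. Let S ⊆ A⊗_k A be a multiplicative set with μ(S) ⊆ A^× and B = S^{-1}(A⊗_k A), and assume the diagonal ideal I·B is generated by the regular sequence θ₁, …, θ_d in B, where θ_i = 1⊗z_i − z_i⊗1. Let j ≥ 1 and β ∈ Ω^j_A. Then there exist γ₁, …, γ_d ∈ Ω^{j-1}_A and δ₁, …, δ_d ∈ Ω^j_A with p₂^*(β) − p₁^*(β) ≡ Σ_{i=1}^d p₁^*(γ_i) ∧ dθ_i + θ_i · p₁^*(δ_i) modulo (J·J)^j in Ω^j_B; and for any such γ_i, δ_i one has: β = 0 if and only if γ_i = 0 for all i = 1, …, d. -/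
set_option maxHeartbeats 1000000
set_option synthInstance.maxHeartbeats 400000

open TensorProduct

noncomputable section

variable (k : Type) [Field k]

/-- The element `d s` of the exterior algebra `⋀_S Ω¹_{S/k}` of Kähler differentials,
i.e. the universal derivation followed by the degree-one inclusion. -/
def dE (S : Type) [CommRing S] [Algebra k S] (s : S) :
    ExteriorAlgebra S (KaehlerDifferential k S) :=
  ExteriorAlgebra.ι S (KaehlerDifferential.D k S s)

/-- `Ω^j_{S/k}`, realized as the degree-`j` component of the exterior algebra of
`Ω¹_{S/k}`, i.e. the `j`-th power of the image of `Ω¹` in the exterior algebra. -/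
def OmegaPow (S : Type) [CommRing S] [Algebra k S] (j : ℕ) :
    Submodule S (ExteriorAlgebra S (KaehlerDifferential k S)) :=
  (LinearMap.range (ExteriorAlgebra.ι S :
    KaehlerDifferential k S →ₗ[S] ExteriorAlgebra S (KaehlerDifferential k S))) ^ j

/-- `J^j`, the degree `j` part of the differential graded ideal of `Ω^•_{S/k}` generated
by an ideal `I ⊆ S`:  `J^0 = I` (inside `Ω^0 = S`), and
`J^j = I·Ω^j + dI ∧ Ω^{j-1}` for `j ≥ 1`. -/
def Jdeg (S : Type) [CommRing S] [Algebra k S] (I : Ideal S) :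
    ℕ → Submodule S (ExteriorAlgebra S (KaehlerDifferential k S))
  | 0 => I • OmegaPow k S 0
  | j + 1 =>
      I • OmegaPow k S (j + 1) ⊔
        Submodule.span S
          {x | ∃ θ ∈ I, ∃ ε ∈ OmegaPow k S j, x = dE k S θ * ε}

/-- `(J·J)^j = Σ_{a+b=j} J^a ∧ J^b`, the degree `j` part of the square of the differential
graded ideal generated by `I`. -/
def JJdeg (S : Type) [CommRing S] [Algebra k S] (I : Ideal S) (j : ℕ) :
    Submodule S (ExteriorAlgebra S (KaehlerDifferential k S)) :=
  ⨆ p : {p : ℕ × ℕ // p.1 + p.2 = j},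
    Submodule.span S
      {x | ∃ y ∈ Jdeg k S I p.1.1, ∃ z ∈ Jdeg k S I p.1.2, x = y * z}

/-- `P` is the map `Ω^•_{S/k} → Ω^•_{T/k}` of exterior algebras of differential forms
induced by a ring homomorphism `φ : S → T` (of `k`-algebras): it is a ring homomorphism
satisfying `P(s·1) = φ(s)·1` on scalars and `P(ds) = d(φ s)` on exact one-forms.  These
two conditions determine `P` uniquely, since the exterior algebra is generated as a ring
by the scalars and the exact one-forms. -/
def IsPullback (S T : Type) [CommRing S] [CommRing T] [Algebra k S] [Algebra k T]
    (φ : S →+* T)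
    (P : ExteriorAlgebra S (KaehlerDifferential k S) →+*
      ExteriorAlgebra T (KaehlerDifferential k T)) : Prop :=
  (∀ s : S, P (algebraMap S (ExteriorAlgebra S (KaehlerDifferential k S)) s) =
    algebraMap T (ExteriorAlgebra T (KaehlerDifferential k T)) (φ s)) ∧
  (∀ s : S, P (dE k S s) = dE k T (φ s))

/-- `θ 0, θ 1, …, θ (d-1)` is a regular sequence in `B`: each `θ i` is a nonzerodivisor
modulo the ideal generated by the previous ones. -/
def IsRegSeq {B : Type*} [CommRing B] {d : ℕ} (θ : Fin d → B) : Prop :=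
  ∀ i : Fin d, ∀ b : B,
    θ i * b ∈ Ideal.span (θ '' {j : Fin d | j < i}) →
      b ∈ Ideal.span (θ '' {j : Fin d | j < i})

theorem omegaPow_zero (S : Type) [CommRing S] [Algebra k S] : OmegaPow k S 0 = 1 :=
  pow_zero _

theorem omegaPow_succ (S : Type) [CommRing S] [Algebra k S] (j : ℕ) :
    OmegaPow k S (j + 1) = OmegaPow k S j * OmegaPow k S 1 := by
  rw [OmegaPow, OmegaPow, OmegaPow, pow_one, pow_succ]

theorem omegaPow_succ' (S : Type) [CommRing S] [Algebra k S] (j : ℕ) :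
    OmegaPow k S (j + 1) = OmegaPow k S 1 * OmegaPow k S j := by
  rw [OmegaPow, OmegaPow, OmegaPow, pow_one, pow_succ']

theorem dE_mem (S : Type) [CommRing S] [Algebra k S] (s : S) : dE k S s ∈ OmegaPow k S 1 := by
  rw [OmegaPow, pow_one]
  exact ⟨_, rfl⟩

theorem omegaPow_one_eq_span (S : Type) [CommRing S] [Algebra k S] :
    OmegaPow k S 1 = Submodule.span S (Set.range (dE k S)) := by
  rw [OmegaPow, pow_one, LinearMap.range_eq_map, ← KaehlerDifferential.span_range_derivation k S,
    Submodule.map_span, ← Set.range_comp]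
  rfl

/-- The span of the differentials of the elements of an ideal. -/
def dSpan (S : Type) [CommRing S] [Algebra k S] (I : Ideal S) :
    Submodule S (ExteriorAlgebra S (KaehlerDifferential k S)) :=
  Submodule.span S (dE k S '' I)

variable {k}

theorem dSpan_le (S : Type) [CommRing S] [Algebra k S] (I : Ideal S) :
    dSpan k S I ≤ OmegaPow k S 1 := by
  rw [dSpan, Submodule.span_le]
  rintro _ ⟨s, -, rfl⟩
  exact dE_mem k S s

theorem dE_mem_dSpan {S : Type} [CommRing S] [Algebra k S] {I : Ideal S} {s : S} (hs : s ∈ I) :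
    dE k S s ∈ dSpan k S I :=
  Submodule.subset_span ⟨s, hs, rfl⟩

theorem mul_neg_of_mem_omegaPow_one {S : Type} [CommRing S] [Algebra k S]
    {x y : ExteriorAlgebra S (KaehlerDifferential k S)}
    (hx : x ∈ OmegaPow k S 1) (hy : y ∈ OmegaPow k S 1) : x * y = -(y * x) := by
  rw [OmegaPow, pow_one] at hx hy
  obtain ⟨a, rfl⟩ := hx
  obtain ⟨b, rfl⟩ := hy
  exact eq_neg_of_add_eq_zero_left (ExteriorAlgebra.ι_add_mul_swap a b)

theorem mul_le_mul_swap_of_le_omegaPow_one {S : Type} [CommRing S] [Algebra k S]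
    {X Y : Submodule S (ExteriorAlgebra S (KaehlerDifferential k S))}
    (hX : X ≤ OmegaPow k S 1) (hY : Y ≤ OmegaPow k S 1) : X * Y ≤ Y * X := by
  rw [Submodule.mul_le]
  intro x hx y hy
  rw [mul_neg_of_mem_omegaPow_one (hX hx) (hY hy)]
  exact neg_mem (Submodule.mul_mem_mul hy hx)

theorem jdeg_zero (S : Type) [CommRing S] [Algebra k S] (I : Ideal S) :
    Jdeg k S I 0 = I • (1 : Submodule S (ExteriorAlgebra S (KaehlerDifferential k S))) := by
  rw [Jdeg, omegaPow_zero]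

theorem jdeg_succ (S : Type) [CommRing S] [Algebra k S] (I : Ideal S) (j : ℕ) :
    Jdeg k S I (j + 1) = I • OmegaPow k S (j + 1) ⊔ dSpan k S I * OmegaPow k S j := by
  rw [Jdeg]
  congr 1
  apply le_antisymm
  · rw [Submodule.span_le]
    rintro _ ⟨s, hs, w, hw, rfl⟩
    exact Submodule.mul_mem_mul (dE_mem_dSpan hs) hw
  · rw [← Submodule.span_eq (OmegaPow k S j), dSpan, Submodule.span_mul_span, Submodule.span_le]
    rintro _ ⟨_, ⟨s, hs, rfl⟩, w, hw, rfl⟩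
    exact Submodule.subset_span ⟨s, hs, w, Submodule.subset_span hw, rfl⟩

theorem smul_omegaPow_le_jdeg (S : Type) [CommRing S] [Algebra k S] (I : Ideal S) (j : ℕ) :
    I • OmegaPow k S j ≤ Jdeg k S I j := by
  cases j with
  | zero => exact le_rfl
  | succ j => exact le_sup_left.trans_eq (jdeg_succ S I j).symm

theorem jdeg_mul_le (S : Type) [CommRing S] [Algebra k S] (I : Ideal S) (j : ℕ) :
    Jdeg k S I j * OmegaPow k S 1 ≤ Jdeg k S I (j + 1) := by
  cases j with
  | zero =>
    rw [jdeg_zero, smul_mul_assoc, one_mul]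
    exact smul_omegaPow_le_jdeg S I 1
  | succ j =>
    rw [jdeg_succ, jdeg_succ, Submodule.sup_mul, smul_mul_assoc, mul_assoc, ← omegaPow_succ,
      ← omegaPow_succ]

theorem mul_jdeg_le (S : Type) [CommRing S] [Algebra k S] (I : Ideal S) (j : ℕ) :
    OmegaPow k S 1 * Jdeg k S I j ≤ Jdeg k S I (j + 1) := by
  cases j with
  | zero =>
    rw [jdeg_zero, mul_smul_comm, mul_one]
    exact smul_omegaPow_le_jdeg S I 1
  | succ j =>
    rw [jdeg_succ, jdeg_succ, Submodule.mul_sup, mul_smul_comm, ← omegaPow_succ', ← mul_assoc,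
      omegaPow_succ' k S j, ← mul_assoc]
    exact sup_le_sup le_rfl (mul_le_mul'
      (mul_le_mul_swap_of_le_omegaPow_one le_rfl (dSpan_le S I)) le_rfl)

theorem omegaPow_mul_jdeg_le (S : Type) [CommRing S] [Algebra k S] (I : Ideal S) (j a : ℕ) :
    OmegaPow k S j * Jdeg k S I a ≤ Jdeg k S I (j + a) := by
  induction j with
  | zero => rw [omegaPow_zero, one_mul, zero_add]
  | succ j ih =>
    rw [omegaPow_succ', mul_assoc, add_right_comm]
    exact (mul_le_mul' le_rfl ih).trans (mul_jdeg_le S I _)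

theorem jjdeg_eq (S : Type) [CommRing S] [Algebra k S] (I : Ideal S) (j : ℕ) :
    JJdeg k S I j = ⨆ p : {p : ℕ × ℕ // p.1 + p.2 = j}, Jdeg k S I p.1.1 * Jdeg k S I p.1.2 := by
  rw [JJdeg]
  congr 1
  ext1 p
  rw [Submodule.mul_eq_span_mul_set]
  congr 1
  ext x
  simp only [Set.mem_ofPred_eq, Set.mem_mul, SetLike.mem_coe, eq_comm]

theorem jdeg_mul_jdeg_le {S : Type} [CommRing S] [Algebra k S] (I : Ideal S) {a b j : ℕ}
    (h : a + b = j) : Jdeg k S I a * Jdeg k S I b ≤ JJdeg k S I j := by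
  rw [jjdeg_eq]
  exact le_iSup (fun p : {p : ℕ × ℕ // p.1 + p.2 = j} ↦ Jdeg k S I p.1.1 * Jdeg k S I p.1.2)
    ⟨(a, b), h⟩

theorem jjdeg_mul_le (S : Type) [CommRing S] [Algebra k S] (I : Ideal S) (j : ℕ) :
    JJdeg k S I j * OmegaPow k S 1 ≤ JJdeg k S I (j + 1) := by
  rw [jjdeg_eq, Submodule.iSup_mul]
  refine iSup_le fun ⟨⟨a, b⟩, h⟩ ↦ ?_
  rw [mul_assoc]
  refine (mul_le_mul' le_rfl (jdeg_mul_le S I b)).trans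
    (jdeg_mul_jdeg_le I (by rw [← add_assoc, show a + b = j from h]))

theorem omegaPow_mul_jjdeg_le (S : Type) [CommRing S] [Algebra k S] (I : Ideal S) (j i : ℕ) :
    OmegaPow k S j * JJdeg k S I i ≤ JJdeg k S I (j + i) := by
  rw [jjdeg_eq, Submodule.mul_iSup]
  refine iSup_le fun ⟨⟨a, b⟩, h⟩ ↦ ?_
  rw [← mul_assoc]
  refine (mul_le_mul' (omegaPow_mul_jdeg_le S I j a) le_rfl).trans
    (jdeg_mul_jdeg_le I (by rw [add_assoc, show a + b = i from h]))

theorem algebraMap_mem_jdeg_zero {S : Type} [CommRing S] [Algebra k S] {I : Ideal S} {s : S}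
    (hs : s ∈ I) : algebraMap S _ s ∈ Jdeg k S I 0 := by
  rw [jdeg_zero, Algebra.algebraMap_eq_smul_one]
  exact Submodule.smul_mem_smul hs (Submodule.one_le.mp le_rfl)

theorem dE_mem_jdeg_one {S : Type} [CommRing S] [Algebra k S] {I : Ideal S} {s : S}
    (hs : s ∈ I) : dE k S s ∈ Jdeg k S I 1 := by
  rw [jdeg_succ, omegaPow_zero, mul_one]
  exact Submodule.mem_sup_right (dE_mem_dSpan hs)

theorem omegaPow_induction {S : Type} [CommRing S] [Algebra k S]
    {P : ∀ (j : ℕ) (x : ExteriorAlgebra S (KaehlerDifferential k S)), x ∈ OmegaPow k S j → Prop}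
    (algebraMap : ∀ s, P 0 (algebraMap S _ s)
      ((omegaPow_zero k S).symm ▸ Submodule.algebraMap_mem s))
    (add : ∀ j x y hx hy, P j x hx → P j y hy → P j (x + y) (add_mem hx hy))
    (mul : ∀ j x s hx, P j x hx → P (j + 1) (x * dE k S s)
      (omegaPow_succ k S j ▸ Submodule.mul_mem_mul hx (dE_mem k S s)))
    (j : ℕ) (x : ExteriorAlgebra S (KaehlerDifferential k S)) (hx : x ∈ OmegaPow k S j) :
    P j x hx := by
  suffices h : ∃ h, P j x h from h.2
  induction j generalizing x with
  | zero =>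
    rw [omegaPow_zero, Submodule.mem_one] at hx
    obtain ⟨s, rfl⟩ := hx
    exact ⟨_, algebraMap s⟩
  | succ j ih =>
    rw [omegaPow_succ] at hx
    induction hx using Submodule.mul_induction_on' with
    | mem_mul_mem y hy w hw =>
      rw [omegaPow_one_eq_span] at hw
      induction hw using Submodule.span_induction generalizing y with
      | mem w hw =>
        obtain ⟨s, rfl⟩ := hw
        exact ⟨_, mul j y s hy (ih y hy).2⟩
      | zero =>
        rw [mul_zero, ← zero_mul (dE k S 0)]
        exact ⟨_, mul j 0 0 (zero_mem _) (ih 0 (zero_mem _)).2⟩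
      | add v w _ _ hv hw =>
        rw [mul_add]
        exact ⟨_, add _ _ _ _ _ (hv y hy).2 (hw y hy).2⟩
      | smul a w _ hw =>
        rw [mul_smul_comm, ← smul_mul_assoc]
        exact hw _ (Submodule.smul_mem _ a hy)
    | add x _ y _ hx hy => exact ⟨_, add _ _ _ _ _ hx.2 hy.2⟩

theorem IsPullback.map_mem_omegaPow {S T : Type} [CommRing S] [CommRing T] [Algebra k S]
    [Algebra k T] {φ : S →+* T} {P : ExteriorAlgebra S (KaehlerDifferential k S) →+*
      ExteriorAlgebra T (KaehlerDifferential k T)} (hP : IsPullback k S T φ P) {j : ℕ}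
    {x : ExteriorAlgebra S (KaehlerDifferential k S)} (hx : x ∈ OmegaPow k S j) :
    P x ∈ OmegaPow k T j := by
  induction j, x, hx using omegaPow_induction with
  | algebraMap s =>
    rw [hP.1, omegaPow_zero]
    exact Submodule.algebraMap_mem _
  | add j x y _ _ hx hy =>
    rw [map_add]
    exact add_mem hx hy
  | mul j x s _ hx =>
    rw [map_mul, hP.2, omegaPow_succ]
    exact Submodule.mul_mem_mul hx (dE_mem k T _)

theorem dE_sub (S : Type) [CommRing S] [Algebra k S] (s t : S) :
    dE k S (s - t) = dE k S s - dE k S t := by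
  simp only [dE, map_sub]

theorem dE_add (S : Type) [CommRing S] [Algebra k S] (s t : S) :
    dE k S (s + t) = dE k S s + dE k S t := by
  simp only [dE, map_add]

theorem dE_sum_mul (S : Type) [CommRing S] [Algebra k S] {n : Type} [Fintype n] (b t : n → S) :
    dE k S (∑ i, b i * t i) =
      ∑ i, (algebraMap S _ (b i) * dE k S (t i) + algebraMap S _ (t i) * dE k S (b i)) := by
  simp only [dE, map_sum, Derivation.leibniz, map_add, map_smul, Algebra.smul_def]

section Difference

variable {A B : Type} [CommRing A] [CommRing B] [Algebra k A] [Algebra k B] {φ₁ φ₂ : A →+* B}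
  {p₁ p₂ : ExteriorAlgebra A (KaehlerDifferential k A) →+*
    ExteriorAlgebra B (KaehlerDifferential k B)} {I : Ideal B}

theorem IsPullback.sub_mem_jdeg (hp₁ : IsPullback k A B φ₁ p₁) (hp₂ : IsPullback k A B φ₂ p₂)
    (hφ : ∀ a, φ₂ a - φ₁ a ∈ I) {j : ℕ}
    {x : ExteriorAlgebra A (KaehlerDifferential k A)} (hx : x ∈ OmegaPow k A j) :
    p₂ x - p₁ x ∈ Jdeg k B I j := by
  induction j, x, hx using omegaPow_induction with
  | algebraMap s =>
    rw [hp₁.1, hp₂.1, ← map_sub]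
    exact algebraMap_mem_jdeg_zero (hφ s)
  | add j x y _ _ hx hy =>
    rw [map_add, map_add, add_sub_add_comm]
    exact add_mem hx hy
  | mul j x s hxj hx =>
    have h : p₂ (x * dE k A s) - p₁ (x * dE k A s) =
        (p₂ x - p₁ x) * dE k B (φ₂ s) + p₁ x * dE k B (φ₂ s - φ₁ s) := by
      rw [map_mul, map_mul, hp₁.2, hp₂.2, dE_sub]
      noncomm_ring
    rw [h]
    exact add_mem (jdeg_mul_le B I j (Submodule.mul_mem_mul hx (dE_mem k B _)))
      (omegaPow_mul_jdeg_le B I j 1 (Submodule.mul_mem_mul (hp₁.map_mem_omegaPow hxj)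
        (dE_mem_jdeg_one (hφ s))))

theorem IsPullback.exists_expansion {n : Type} [Fintype n] {θ : n → B}
    (hI : I = Ideal.span (Set.range θ))
    (hp₁ : IsPullback k A B φ₁ p₁) (hp₂ : IsPullback k A B φ₂ p₂)
    (hφ : ∀ a, φ₂ a - φ₁ a ∈ I) (hsurj : ∀ b, ∃ a, b - φ₁ a ∈ I) (j : ℕ)
    (β : ExteriorAlgebra A (KaehlerDifferential k A)) (hβ : β ∈ OmegaPow k A j) :
    ∃ γ δ : n → ExteriorAlgebra A (KaehlerDifferential k A),
      ((∀ i, γ i ∈ OmegaPow k A (j - 1)) ∧ (j = 0 → γ = 0)) ∧ (∀ i, δ i ∈ OmegaPow k A j) ∧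
      (p₂ β - p₁ β) - ∑ i, (p₁ (γ i) * dE k B (θ i) + θ i • p₁ (δ i)) ∈ JJdeg k B I j := by
  have hθ : ∀ i, θ i ∈ I := fun i ↦ hI ▸ Ideal.subset_span ⟨i, rfl⟩
  have key : ∀ s, ∃ (a : n → A) (e : n → B), (∀ i, e i ∈ I) ∧
      φ₂ s - φ₁ s = ∑ i, (φ₁ (a i) + e i) * θ i := by
    intro s
    have hs := hφ s
    rw [hI, Ideal.mem_span_range_iff_exists_fun] at hs
    obtain ⟨b, hb⟩ := hs
    choose a ha using fun i ↦ hsurj (b i)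
    refine ⟨a, fun i ↦ b i - φ₁ (a i), ha, ?_⟩
    rw [← hb]
    simp
  induction j, β, hβ using omegaPow_induction with
  | algebraMap s =>
    obtain ⟨a, e, he, hs⟩ := key s
    refine ⟨0, fun i ↦ algebraMap A _ (a i), ⟨fun i ↦ zero_mem _, fun _ ↦ rfl⟩, fun i ↦ ?_, ?_⟩
    · rw [omegaPow_zero]
      exact Submodule.algebraMap_mem _
    · have h : p₂ (algebraMap A _ s) - p₁ (algebraMap A _ s) -
          ∑ i, (p₁ ((0 : n → ExteriorAlgebra A (KaehlerDifferential k A)) i) * dE k B (θ i) +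
            θ i • p₁ (algebraMap A _ (a i))) =
          ∑ i, algebraMap B (ExteriorAlgebra B (KaehlerDifferential k B)) (e i) *
            algebraMap B _ (θ i) := by
        rw [hp₁.1, hp₂.1, ← map_sub, hs, map_sum, ← Finset.sum_sub_distrib]
        refine Finset.sum_congr rfl fun i _ ↦ ?_
        rw [hp₁.1, Algebra.smul_def, ← map_mul, ← map_mul, Pi.zero_apply, map_zero, zero_mul,
          zero_add, ← map_sub]
        congr 1
        ring
      rw [h]
      exact sum_mem fun i _ ↦ jdeg_mul_jdeg_le I (add_zero 0) (Submodule.mul_mem_mul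
        (algebraMap_mem_jdeg_zero (he i)) (algebraMap_mem_jdeg_zero (hθ i)))
  | add j x y _ _ hx hy =>
    obtain ⟨γ, δ, ⟨hγ, hγ0⟩, hδ, h⟩ := hx
    obtain ⟨γ', δ', ⟨hγ', hγ0'⟩, hδ', h'⟩ := hy
    refine ⟨γ + γ', δ + δ', ⟨fun i ↦ add_mem (hγ i) (hγ' i), fun hj ↦ ?_⟩,
      fun i ↦ add_mem (hδ i) (hδ' i), ?_⟩
    · rw [hγ0 hj, hγ0' hj, add_zero]
    · convert add_mem h h' using 1
      simp only [Pi.add_apply, map_add, add_mul, smul_add, Finset.sum_add_distrib]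
      abel
  | mul j x s hxj hx =>
    obtain ⟨γ, δ, ⟨hγ, hγ0⟩, hδ, h⟩ := hx
    obtain ⟨a, e, he, hs⟩ := key s
    refine ⟨fun i ↦ x * algebraMap A _ (a i) - γ i * dE k A s,
      fun i ↦ δ i * dE k A s + x * dE k A (a i), ⟨fun i ↦ ?_, fun h ↦ by omega⟩, fun i ↦ ?_, ?_⟩
    · rw [Nat.add_sub_cancel]
      beta_reduce
      rw [← Algebra.commutes, ← Algebra.smul_def]
      refine sub_mem (Submodule.smul_mem _ _ hxj) ?_
      cases j with
      | zero => simp [hγ0 rfl]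
      | succ j =>
        rw [omegaPow_succ]
        exact Submodule.mul_mem_mul (hγ i) (dE_mem k A s)
    · rw [omegaPow_succ]
      exact add_mem (Submodule.mul_mem_mul (hδ i) (dE_mem k A s))
        (Submodule.mul_mem_mul hxj (dE_mem k A _))
    · have hJ : ∑ i, (algebraMap B _ (e i) * dE k B (θ i) + algebraMap B _ (θ i) * dE k B (e i)) ∈
          JJdeg k B I 1 := by
        refine sum_mem fun i _ ↦ add_mem ?_ ?_
        · exact jdeg_mul_jdeg_le I (zero_add 1) (Submodule.mul_mem_mul
            (algebraMap_mem_jdeg_zero (he i)) (dE_mem_jdeg_one (hθ i)))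
        · exact jdeg_mul_jdeg_le I (zero_add 1) (Submodule.mul_mem_mul
            (algebraMap_mem_jdeg_zero (hθ i)) (dE_mem_jdeg_one (he i)))
      have hd := congrArg (dE k B) hs
      rw [dE_sum_mul, dE_sub] at hd
      have hxs : p₂ (x * dE k A s) - p₁ (x * dE k A s) - ∑ i,
          (p₁ (x * algebraMap A _ (a i) - γ i * dE k A s) * dE k B (θ i) +
            θ i • p₁ (δ i * dE k A s + x * dE k A (a i))) =
          (p₂ x - p₁ x) * dE k B (φ₂ s - φ₁ s) +
          (p₂ x - p₁ x - ∑ i, (p₁ (γ i) * dE k B (θ i) + θ i • p₁ (δ i))) * dE k B (φ₁ s) +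
          p₁ x * ∑ i, (algebraMap B _ (e i) * dE k B (θ i) +
            algebraMap B _ (θ i) * dE k B (e i)) := by
        have h₁ : ∑ i, (p₁ (x * algebraMap A _ (a i) - γ i * dE k A s) * dE k B (θ i) +
            θ i • p₁ (δ i * dE k A s + x * dE k A (a i))) =
            (∑ i, (p₁ (γ i) * dE k B (θ i) + θ i • p₁ (δ i))) * dE k B (φ₁ s) +
            p₁ x * ∑ i, (algebraMap B _ (φ₁ (a i)) * dE k B (θ i) +
              algebraMap B _ (θ i) * dE k B (φ₁ (a i))) := by
          rw [Finset.sum_mul, Finset.mul_sum, ← Finset.sum_add_distrib]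
          refine Finset.sum_congr rfl fun i _ ↦ ?_
          rw [map_sub, map_add, map_mul, map_mul, map_mul, map_mul, hp₁.1, hp₁.2, hp₁.2, add_mul,
            sub_mul, mul_assoc (p₁ (γ i)), mul_assoc (p₁ (γ i)),
            mul_neg_of_mem_omegaPow_one (dE_mem k B (φ₁ s)) (dE_mem k B (θ i)), mul_add, smul_add,
            smul_mul_assoc, ← Algebra.smul_def (θ i), mul_smul_comm, mul_neg, mul_assoc]
          abel
        have h₂ : dE k B (φ₂ s) - dE k B (φ₁ s) =
            ∑ i, (algebraMap B _ (φ₁ (a i)) * dE k B (θ i) +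
              algebraMap B _ (θ i) * dE k B (φ₁ (a i))) +
            ∑ i, (algebraMap B _ (e i) * dE k B (θ i) + algebraMap B _ (θ i) * dE k B (e i)) := by
          rw [hd, ← Finset.sum_add_distrib]
          refine Finset.sum_congr rfl fun i _ ↦ ?_
          rw [map_add, dE_add]
          noncomm_ring
        rw [h₁, dE_sub, map_mul, map_mul, hp₁.2, hp₂.2, eq_sub_of_add_eq' h₂.symm]
        noncomm_ring
      rw [hxs]
      refine add_mem (add_mem ?_ ?_) ?_
      · exact jdeg_mul_jdeg_le I rfl (Submodule.mul_mem_mul (hp₁.sub_mem_jdeg hp₂ hφ hxj)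
          (dE_mem_jdeg_one (hφ s)))
      · exact jjdeg_mul_le B I j (Submodule.mul_mem_mul h (dE_mem k B _))
      · exact omegaPow_mul_jjdeg_le B I j 1
          (Submodule.mul_mem_mul (hp₁.map_mem_omegaPow hxj) hJ)

end Difference

theorem exteriorAlgebra_ringHom_ext {S R : Type*} {M : Type*} [CommRing S] [AddCommGroup M]
    [Module S M] [Ring R] {s : Set M} (hs : Submodule.span S s = ⊤)
    {F G : ExteriorAlgebra S M →+* R} (h₀ : ∀ a, F (algebraMap S _ a) = G (algebraMap S _ a))
    (h₁ : ∀ m ∈ s, F (ExteriorAlgebra.ι S m) = G (ExteriorAlgebra.ι S m)) : F = G := by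
  ext x
  induction x using ExteriorAlgebra.induction with
  | algebraMap a => exact h₀ a
  | ι m =>
    have hm : m ∈ Submodule.span S s := hs ▸ Submodule.mem_top
    induction hm using Submodule.span_induction with
    | mem m hm => exact h₁ m hm
    | zero => simp only [map_zero]
    | add m n _ _ hm hn => simp only [map_add, hm, hn]
    | smul a m _ hm => simp only [map_smul, Algebra.smul_def, map_mul, h₀, hm]
  | mul x y hx hy => simp only [map_mul, hx, hy]
  | add x y hx hy => simp only [map_add, hx, hy]

theorem ι_mul_mul_ι {R M : Type*} [CommRing R] [AddCommGroup M] [Module R M] (m : M)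
    (x : ExteriorAlgebra R M) :
    ExteriorAlgebra.ι R m * x * ExteriorAlgebra.ι R m = 0 := by
  have h : ExteriorAlgebra.ι R m * x =
      CliffordAlgebra.involute (Q := (0 : QuadraticForm R M)) x * ExteriorAlgebra.ι R m := by
    induction x using ExteriorAlgebra.induction with
    | algebraMap r => rw [AlgHom.commutes, Algebra.commutes]
    | ι n =>
      rw [CliffordAlgebra.involute_ι, neg_mul]
      exact eq_neg_of_add_eq_zero_left (ExteriorAlgebra.ι_add_mul_swap m n)
    | mul x y hx hy => rw [map_mul, ← mul_assoc, hx, mul_assoc, hy, mul_assoc]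
    | add x y hx hy => rw [map_add, mul_add, add_mul, hx, hy]
  rw [h, mul_assoc, ExteriorAlgebra.ι_sq_zero, mul_zero]

theorem contractRight_map_inl {R M : Type*} [CommRing R] [AddCommGroup M] [Module R M]
    (x : ExteriorAlgebra R M) :
    CliffordAlgebra.contractRight (Q := (0 : QuadraticForm R (M × R)))
      (ExteriorAlgebra.map (LinearMap.inl R M R) x) (LinearMap.snd R M R) = 0 := by
  induction x using CliffordAlgebra.right_induction with
  | algebraMap r => rw [AlgHom.commutes, CliffordAlgebra.contractRight_algebraMap]
  | add x y hx hy => rw [map_add, map_add, LinearMap.add_apply, hx, hy, add_zero]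
  | mul_ι m x hx =>
    rw [map_mul]
    refine (congrArg (fun z ↦ CliffordAlgebra.contractRight (Q := (0 : QuadraticForm R (M × R)))
      (ExteriorAlgebra.map (LinearMap.inl R M R) x * z) (LinearMap.snd R M R))
      (ExteriorAlgebra.map_apply_ι (LinearMap.inl R M R) m)).trans ?_
    refine (CliffordAlgebra.contractRight_mul_ι _ _ _).trans ?_
    rw [hx, LinearMap.inl_apply, LinearMap.snd_apply, zero_smul, zero_mul, sub_zero]

theorem eq_zero_of_map_inl_mul_ι_inr {R M : Type*} [CommRing R] [AddCommGroup M] [Module R M]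
    {x : ExteriorAlgebra R M}
    (hx : ExteriorAlgebra.map (LinearMap.inl R M R) x * ExteriorAlgebra.ι R ((0, 1) : M × R) = 0) :
    x = 0 := by
  have h := CliffordAlgebra.contractRight_mul_ι (Q := (0 : QuadraticForm R (M × R)))
    (LinearMap.snd R M R) (0, 1) (ExteriorAlgebra.map (LinearMap.inl R M R) x)
  rw [contractRight_map_inl, zero_mul, sub_zero, LinearMap.snd_apply, one_smul] at h
  refine ExteriorAlgebra.map_injective ⟨LinearMap.fst R M R, LinearMap.fst_comp_inl ..⟩ ?_
  rw [map_zero, ← h]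
  exact (congrArg (fun y ↦ CliffordAlgebra.contractRight (Q := (0 : QuadraticForm R (M × R)))
    y (LinearMap.snd R M R)) hx).trans (by simp)

/-- A `k`-linear map from `B` to an `A`-module that is a derivation along a ring homomorphism
`m : B → A` induces a ring homomorphism from the forms on `B` to an exterior algebra over `A`. -/
theorem exists_exteriorAlgebra_ringHom {A B N : Type} [CommRing A] [CommRing B] [Algebra k B]
    [AddCommGroup N] [Module A N] (m : B →+* A) (f : B →+ N)
    (hf : ∀ b c, f (b * c) = m b • f c + m c • f b) (hfk : ∀ r, f (algebraMap k B r) = 0) :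
    ∃ Ψ : ExteriorAlgebra B (KaehlerDifferential k B) →+* ExteriorAlgebra A N,
      (∀ b, Ψ (algebraMap B _ b) = algebraMap A _ (m b)) ∧
      ∀ b, Ψ (dE k B b) = ExteriorAlgebra.ι A (f b) := by
  let _ : Algebra B A := m.toAlgebra
  let _ : Module B N := Module.compHom N m
  have : IsScalarTower B A N := ⟨fun b a n ↦ mul_smul (m b) a n⟩
  let _ : Module k N := Module.compHom N (algebraMap k B)
  have : IsScalarTower k B N := ⟨fun r b n ↦ by
    rw [Algebra.smul_def, mul_smul]; rfl⟩
  let D : Derivation k B N :=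
    { toFun := f
      map_add' := map_add f
      map_smul' := fun r b ↦ by
        rw [Algebra.smul_def, hf, hfk, smul_zero, add_zero]; rfl
      map_one_eq_zero' := by
        simpa using hfk 1
      leibniz' := hf }
  let Ψ : ExteriorAlgebra B (KaehlerDifferential k B) →ₐ[B] ExteriorAlgebra A N :=
    ExteriorAlgebra.lift B
      ⟨((ExteriorAlgebra.ι A).restrictScalars B).comp D.liftKaehlerDifferential,
        fun x ↦ ExteriorAlgebra.ι_sq_zero _⟩
  refine ⟨Ψ.toRingHom, fun b ↦ Ψ.commutes b, fun b ↦ ?_⟩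
  change Ψ (ExteriorAlgebra.ι B _) = _
  refine (ExteriorAlgebra.lift_ι_apply B _ _ _).trans ?_
  change ExteriorAlgebra.ι A (D.liftKaehlerDifferential (KaehlerDifferential.D k B b)) = _
  rw [Derivation.liftKaehlerDifferential_comp_D]
  rfl

theorem map_jjdeg_eq_zero {A B N : Type} [CommRing A] [CommRing B] [Algebra k B]
    [AddCommGroup N] [Module A N] {m : B →+* A} {f : B → N}
    {Ψ : ExteriorAlgebra B (KaehlerDifferential k B) →+* ExteriorAlgebra A N}
    (hΨ₀ : ∀ b, Ψ (algebraMap B _ b) = algebraMap A _ (m b))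
    (hΨ₁ : ∀ b, Ψ (dE k B b) = ExteriorAlgebra.ι A (f b)) {I : Ideal B} {ε : N}
    (hm : ∀ b ∈ I, m b = 0) (hf : ∀ b ∈ I, ∃ a : A, f b = a • ε) {j : ℕ}
    {x : ExteriorAlgebra B (KaehlerDifferential k B)} (hx : x ∈ JJdeg k B I j) : Ψ x = 0 := by
  have hsmul : ∀ (b : B) x, Ψ (b • x) = algebraMap A _ (m b) * Ψ x := fun b x ↦ by
    rw [Algebra.smul_def, map_mul, hΨ₀]
  have hI : ∀ (P : Submodule B (ExteriorAlgebra B (KaehlerDifferential k B))), ∀ y ∈ I • P,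
      ∃ w, Ψ y = ExteriorAlgebra.ι A ε * w := by
    intro P y hy
    refine ⟨0, ?_⟩
    rw [mul_zero]
    induction hy using Submodule.smul_induction_on' with
    | smul b hb z hz => rw [hsmul, hm b hb, map_zero, zero_mul]
    | add y _ z _ hy hz => rw [map_add, hy, hz, add_zero]
  have hJ : ∀ a, ∀ y ∈ Jdeg k B I a, ∃ w, Ψ y = ExteriorAlgebra.ι A ε * w := by
    intro a y hy
    cases a with
    | zero => exact hI _ y hy
    | succ a =>
      rw [jdeg_succ] at hy
      obtain ⟨u, hu, v, hv, rfl⟩ := Submodule.mem_sup.mp hy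
      obtain ⟨w, hw⟩ := hI _ u hu
      suffices h : ∃ w, Ψ v = ExteriorAlgebra.ι A ε * w by
        obtain ⟨w', hw'⟩ := h
        exact ⟨w + w', by rw [map_add, hw, hw', mul_add]⟩
      clear hy
      induction hv using Submodule.mul_induction_on' with
      | mem_mul_mem s hs t ht =>
        suffices h : ∃ w, Ψ s = ExteriorAlgebra.ι A ε * w by
          obtain ⟨w, hw⟩ := h
          exact ⟨w * Ψ t, by rw [map_mul, hw, mul_assoc]⟩
        rw [dSpan] at hs
        induction hs using Submodule.span_induction with
        | mem s hs =>
          obtain ⟨b, hb, rfl⟩ := hs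
          obtain ⟨a, ha⟩ := hf b hb
          exact ⟨algebraMap A _ a, by
            rw [hΨ₁, ha, map_smul, Algebra.smul_def, Algebra.commutes]⟩
        | zero => exact ⟨0, by simp⟩
        | add s t _ _ hs ht =>
          obtain ⟨w, hw⟩ := hs
          obtain ⟨w', hw'⟩ := ht
          exact ⟨w + w', by rw [map_add, hw, hw', mul_add]⟩
        | smul b s _ hs =>
          obtain ⟨w, hw⟩ := hs
          exact ⟨algebraMap A _ (m b) * w, by
            rw [hsmul, hw, ← mul_assoc, ← mul_assoc, Algebra.commutes]⟩
      | add s _ t _ hs ht =>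
        obtain ⟨w, hw⟩ := hs
        obtain ⟨w', hw'⟩ := ht
        exact ⟨w + w', by rw [map_add, hw, hw', mul_add]⟩
  rw [jjdeg_eq] at hx
  induction hx using Submodule.iSup_induction' with
  | mem p x hx =>
    induction hx using Submodule.mul_induction_on' with
    | mem_mul_mem y hy z hz =>
      obtain ⟨w, hw⟩ := hJ _ y hy
      obtain ⟨w', hw'⟩ := hJ _ z hz
      rw [map_mul, hw, hw', ← mul_assoc, ι_mul_mul_ι, zero_mul]
    | add x _ y _ hx hy => rw [map_add, hx, hy, add_zero]
  | zero => exact map_zero Ψ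
  | add x y _ _ hx hy => rw [map_add, hx, hy, add_zero]

theorem sub_sum_smul_eq_self {R M n : Type*} [CommRing R] [AddCommGroup M] [Module R M]
    (c : n → M →ₗ[R] R) (z : n → M) {β : ExteriorAlgebra R M} [DecidableEq n]
    (hc : ∀ i l, c i (z l) = if i = l then 1 else 0)
    (h : ∀ i, ExteriorAlgebra.map (LinearMap.id - (c i).smulRight (z i)) β = β) (s : Finset n) :
    ExteriorAlgebra.map (LinearMap.id - ∑ i ∈ s, (c i).smulRight (z i)) β = β := by
  induction s using Finset.induction_on with
  | empty => rw [Finset.sum_empty, sub_zero, ExteriorAlgebra.map_id, AlgHom.id_apply]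
  | insert i s hi ih =>
    have hcomp : (LinearMap.id - ∑ l ∈ insert i s, (c l).smulRight (z l) : M →ₗ[R] M) =
        (LinearMap.id - (c i).smulRight (z i)) ∘ₗ
          (LinearMap.id - ∑ l ∈ s, (c l).smulRight (z l)) := by
      ext ω
      have h0 : ∀ l ∈ s, c l ω • (z l - (if i = l then 1 else 0 : R) • z i) = c l ω • z l :=
        fun l hl ↦ by
          have hil : i ≠ l := by
            rintro rfl
            exact hi hl
          rw [if_neg hil, zero_smul, sub_zero]
      simp only [Finset.sum_insert hi, LinearMap.sub_apply, LinearMap.id_apply,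
        LinearMap.add_apply, LinearMap.sum_apply, LinearMap.smulRight_apply,
        LinearMap.comp_apply, map_sub, map_sum, map_smul, hc, Finset.sum_congr rfl h0]
      abel
    rw [hcomp, ← ExteriorAlgebra.map_comp_map, AlgHom.comp_apply, ih, h i]

theorem map_zero_eq_zero_of_mem_omegaPow {S : Type} [CommRing S] [Algebra k S] {j : ℕ}
    (hj : 1 ≤ j) {x : ExteriorAlgebra S (KaehlerDifferential k S)} (hx : x ∈ OmegaPow k S j) :
    ExteriorAlgebra.map (0 : KaehlerDifferential k S →ₗ[S] KaehlerDifferential k S) x = 0 := by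
  induction j, x, hx using omegaPow_induction with
  | algebraMap s => omega
  | add j x y _ _ hx hy => rw [map_add, hx hj, hy hj, add_zero]
  | mul j x s _ _ =>
    rw [map_mul, dE, ExteriorAlgebra.map_apply_ι, LinearMap.zero_apply, map_zero, mul_zero]

theorem IsPullback.eq_comp {S T R : Type} [CommRing S] [CommRing T] [Algebra k S]
    [Algebra k T] [Ring R] {φ : S →+* T} {P : ExteriorAlgebra S (KaehlerDifferential k S) →+*
      ExteriorAlgebra T (KaehlerDifferential k T)} (hP : IsPullback k S T φ P)
    [Algebra S R] {Ψ : ExteriorAlgebra T (KaehlerDifferential k T) →+* R}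
    (F : ExteriorAlgebra S (KaehlerDifferential k S) →ₐ[S] R)
    (h₀ : ∀ s, Ψ (algebraMap T _ (φ s)) = algebraMap S R s)
    (h₁ : ∀ s, Ψ (dE k T (φ s)) = F (dE k S s))
    (x : ExteriorAlgebra S (KaehlerDifferential k S)) : Ψ (P x) = F x := by
  have h : Ψ.comp P = (F : ExteriorAlgebra S (KaehlerDifferential k S) →+* R) := by
    refine exteriorAlgebra_ringHom_ext (KaehlerDifferential.span_range_derivation k S)
      (fun s ↦ ?_) ?_
    · rw [RingHom.comp_apply, hP.1, h₀]
      exact (F.commutes s).symm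
    · rintro _ ⟨s, rfl⟩
      exact (congrArg Ψ (hP.2 s)).trans (h₁ s)
  exact congrArg (fun f ↦ f x) h

/-- Specializing the expansion of `p₂ β - p₁ β` along the diagonal, in the direction of a
linear form `c` on the differentials of `A`. -/
theorem IsPullback.map_sub_map_eq {A B n : Type} [CommRing A] [CommRing B] [Algebra k A]
    [Algebra k B] [Fintype n] [DecidableEq n] {φ₁ φ₂ : A →+* B}
    {p₁ p₂ : ExteriorAlgebra A (KaehlerDifferential k A) →+*
      ExteriorAlgebra B (KaehlerDifferential k B)} {I : Ideal B}
    (hp₁ : IsPullback k A B φ₁ p₁) (hp₂ : IsPullback k A B φ₂ p₂)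
    (hφ : ∀ r, φ₁ (algebraMap k A r) = algebraMap k B r)
    (c : KaehlerDifferential k A →ₗ[A] A) (G : B →+* TrivSqZeroExt A A)
    (hG₁ : ∀ a, G (φ₁ a) = TrivSqZeroExt.inl a)
    (hG₂ : ∀ a, G (φ₂ a) =
      TrivSqZeroExt.inl a + TrivSqZeroExt.inr (c (KaehlerDifferential.D k A a)))
    (hGI : ∀ b ∈ I, (G b).fst = 0) (z : n → A) (i : n)
    (hc : ∀ l, c (KaehlerDifferential.D k A (z l)) = if i = l then 1 else 0)
    (hz : ∀ l, φ₂ (z l) - φ₁ (z l) ∈ I)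
    {β : ExteriorAlgebra A (KaehlerDifferential k A)}
    {γ δ : n → ExteriorAlgebra A (KaehlerDifferential k A)} {j : ℕ}
    (h : (p₂ β - p₁ β) - ∑ l, (p₁ (γ l) * dE k B (φ₂ (z l) - φ₁ (z l)) +
      (φ₂ (z l) - φ₁ (z l)) • p₁ (δ l)) ∈ JJdeg k B I j) :
    ExteriorAlgebra.map (LinearMap.prod LinearMap.id c) β -
        ExteriorAlgebra.map (LinearMap.inl A (KaehlerDifferential k A) A) β =
      ExteriorAlgebra.map (LinearMap.inl A (KaehlerDifferential k A) A) (γ i) *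
        ExteriorAlgebra.ι A (0, 1) := by
  let m : B →+* A := (TrivSqZeroExt.fstHom A A A).toRingHom.comp G
  have hm : ∀ b, m b = (G b).fst := fun b ↦ rfl
  let f : B →+ KaehlerDifferential k A × A :=
    { toFun := fun b ↦ (KaehlerDifferential.D k A (m b), (G b).snd)
      map_zero' := by simp
      map_add' := fun b b' ↦ by simp }
  have hfdef : ∀ b, f b = (KaehlerDifferential.D k A (m b), (G b).snd) := fun b ↦ rfl
  obtain ⟨Ψ, hΨ₀, hΨ₁⟩ := exists_exteriorAlgebra_ringHom m f
    (fun b b' ↦ by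
      rw [hfdef, hfdef, hfdef, map_mul m, map_mul G, Derivation.leibniz, TrivSqZeroExt.snd_mul,
        op_smul_eq_smul, ← hm, ← hm, Prod.smul_mk, Prod.smul_mk, Prod.mk_add_mk])
    (fun r ↦ by
      rw [hfdef, hm, ← hφ, hG₁, TrivSqZeroExt.fst_inl, TrivSqZeroExt.snd_inl,
        Derivation.map_algebraMap]
      rfl)
  have hΨp₁ : ∀ x, Ψ (p₁ x) = ExteriorAlgebra.map (LinearMap.inl A (KaehlerDifferential k A) A) x :=
    hp₁.eq_comp (ExteriorAlgebra.map (LinearMap.inl A (KaehlerDifferential k A) A))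
      (fun a ↦ by
        rw [hΨ₀, hm, hG₁, TrivSqZeroExt.fst_inl])
      (fun a ↦ by
        rw [hΨ₁, hfdef, hm, hG₁, TrivSqZeroExt.fst_inl, TrivSqZeroExt.snd_inl, dE,
          ExteriorAlgebra.map_apply_ι, LinearMap.inl_apply])
  have hΨp₂ : ∀ x, Ψ (p₂ x) = ExteriorAlgebra.map (LinearMap.prod LinearMap.id c) x :=
    hp₂.eq_comp (ExteriorAlgebra.map (LinearMap.prod LinearMap.id c))
      (fun a ↦ by
        rw [hΨ₀, hm, hG₂, TrivSqZeroExt.fst_add, TrivSqZeroExt.fst_inl, TrivSqZeroExt.fst_inr,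
          add_zero])
      (fun a ↦ by
        rw [hΨ₁, hfdef, hm, hG₂, TrivSqZeroExt.fst_add, TrivSqZeroExt.fst_inl,
          TrivSqZeroExt.fst_inr, add_zero, TrivSqZeroExt.snd_add, TrivSqZeroExt.snd_inl,
          TrivSqZeroExt.snd_inr, zero_add, dE, ExteriorAlgebra.map_apply_ι]
        rfl)
  have h0 := map_jjdeg_eq_zero (f := f) (ε := ((0, 1) : KaehlerDifferential k A × A)) hΨ₀ hΨ₁ hGI
    (fun b hb ↦ ⟨(G b).snd, by
      rw [hfdef, hm, hGI b hb, map_zero, Prod.smul_mk, smul_zero, smul_eq_mul, mul_one]⟩) h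
  have hθ : ∀ l, f (φ₂ (z l) - φ₁ (z l)) = (0, if i = l then 1 else 0) := fun l ↦ by
    rw [hfdef, hm, hGI _ (hz l), map_zero, map_sub, hG₁, hG₂, TrivSqZeroExt.snd_sub,
      TrivSqZeroExt.snd_add, TrivSqZeroExt.snd_inl, TrivSqZeroExt.snd_inr, zero_add, sub_zero, hc]
  rw [map_sub, map_sub, hΨp₁, hΨp₂, map_sum, sub_eq_zero] at h0
  rw [h0, Finset.sum_eq_single i]
  · rw [map_add, map_mul, hΨp₁, hΨ₁, hθ, if_pos rfl, Algebra.smul_def, map_mul, hΨ₀, hm,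
      hGI _ (hz i), map_zero, zero_mul, add_zero]
  · intro l _ hl
    rw [map_add, map_mul, hΨ₁, hθ, if_neg hl.symm, Algebra.smul_def, map_mul, hΨ₀, hm,
      hGI _ (hz l), map_zero, zero_mul, add_zero, Prod.mk_zero_zero, map_zero, mul_zero]
  · exact fun hi ↦ (hi (Finset.mem_univ i)).elim

/-- The coordinates of the differentials of an étale algebra over a polynomial ring. -/
theorem exists_kaehlerDifferential_coord (d : ℕ) (A : Type) [CommRing A] [Algebra k A]
    [Algebra (MvPolynomial (Fin d) k) A] [IsScalarTower k (MvPolynomial (Fin d) k) A]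
    [Algebra.FormallyEtale (MvPolynomial (Fin d) k) A] :
    ∃ c : Fin d → KaehlerDifferential k A →ₗ[A] A,
      (∀ ω, ω = ∑ i, c i ω • KaehlerDifferential.D k A
        (algebraMap (MvPolynomial (Fin d) k) A (MvPolynomial.X i))) ∧
      ∀ i l, c i (KaehlerDifferential.D k A
        (algebraMap (MvPolynomial (Fin d) k) A (MvPolynomial.X l))) = if i = l then 1 else 0 := by
  let b := ((KaehlerDifferential.mvPolynomialBasis k (Fin d)).baseChange A).map
    (KaehlerDifferential.tensorKaehlerEquivOfFormallyEtale k (MvPolynomial (Fin d) k) A)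
  have hX : ∀ i, KaehlerDifferential.mvPolynomialBasis k (Fin d) i =
      KaehlerDifferential.D k (MvPolynomial (Fin d) k) (MvPolynomial.X i) := fun i ↦ by
    apply (KaehlerDifferential.mvPolynomialBasis k (Fin d)).repr.injective
    rw [KaehlerDifferential.mvPolynomialBasis_repr_D_X, Module.Basis.repr_self]
  have hb : ∀ i, b i = KaehlerDifferential.D k A
      (algebraMap (MvPolynomial (Fin d) k) A (MvPolynomial.X i)) := fun i ↦ by
    rw [Module.Basis.map_apply, Module.Basis.baseChange_apply, hX,
      KaehlerDifferential.tensorKaehlerEquivOfFormallyEtale_apply,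
      KaehlerDifferential.mapBaseChange_tmul, one_smul, KaehlerDifferential.map_D]
  refine ⟨b.coord, fun ω ↦ ?_, fun i l ↦ ?_⟩
  · simp only [← hb, Module.Basis.coord_apply, b.sum_repr]
  · rw [← hb, Module.Basis.coord_apply, Module.Basis.repr_self, Finsupp.single_apply]
    exact if_congr eq_comm rfl rfl

section Diagonal

variable {A B : Type} [CommRing A] [Algebra k A] [CommRing B] [Algebra (A ⊗[k] A) B]

theorem exists_ringHom_trivSqZeroExt (M : Submonoid (A ⊗[k] A)) [IsLocalization M B]
    (hM : ∀ x ∈ M, IsUnit ((Algebra.TensorProduct.lmul' k (S := A) : A ⊗[k] A →ₐ[k] A) x))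
    (c : KaehlerDifferential k A →ₗ[A] A) :
    ∃ G : B →+* TrivSqZeroExt A A,
      (∀ a : A, G (algebraMap (A ⊗[k] A) B (a ⊗ₜ 1)) = TrivSqZeroExt.inl a) ∧
      (∀ a : A, G (algebraMap (A ⊗[k] A) B (1 ⊗ₜ a)) =
        TrivSqZeroExt.inl a + TrivSqZeroExt.inr (c (KaehlerDifferential.D k A a))) ∧
      ∀ x : A ⊗[k] A, (G (algebraMap (A ⊗[k] A) B x)).fst = Algebra.TensorProduct.lmul' k x := by
  let g : A →ₐ[k] TrivSqZeroExt A A :=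
    { toFun := fun a ↦
        TrivSqZeroExt.inl a + TrivSqZeroExt.inr (c (KaehlerDifferential.D k A a))
      map_one' := by simp
      map_zero' := by simp
      map_add' := fun a b ↦ by ext <;> simp
      map_mul' := fun a b ↦ by ext <;> simp [mul_comm]
      commutes' := fun r ↦ by ext <;> simp [TrivSqZeroExt.algebraMap_eq_inl'] }
  let F : A ⊗[k] A →ₐ[k] TrivSqZeroExt A A :=
    Algebra.TensorProduct.lift (TrivSqZeroExt.inlAlgHom k A A) g fun _ _ ↦ Commute.all _ _
  have hF : ∀ x, (F x).fst = Algebra.TensorProduct.lmul' k x := fun x ↦ by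
    have h : (TrivSqZeroExt.fstHom k A A).comp F = Algebra.TensorProduct.lmul' k := by
      ext a <;> simp [F, g]
    exact congrArg (fun f ↦ f x) h
  have hu : ∀ y : M, IsUnit (F.toRingHom y) := fun y ↦ by
    refine TrivSqZeroExt.isUnit_iff_isUnit_fst.mpr ?_
    exact (hF y).symm ▸ hM y y.2
  refine ⟨IsLocalization.lift hu, fun a ↦ ?_, fun a ↦ ?_, fun x ↦ ?_⟩
  · rw [IsLocalization.lift_eq]
    simp [F]
  · rw [IsLocalization.lift_eq]
    simp [F, g]
  · rw [IsLocalization.lift_eq]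
    exact hF x

theorem exists_sub_mem_map_ideal (M : Submonoid (A ⊗[k] A)) [IsLocalization M B]
    (hM : ∀ x ∈ M, IsUnit ((Algebra.TensorProduct.lmul' k (S := A) : A ⊗[k] A →ₐ[k] A) x))
    (b : B) : ∃ a : A, b - algebraMap (A ⊗[k] A) B (a ⊗ₜ 1) ∈
      Ideal.map (algebraMap (A ⊗[k] A) B) (KaehlerDifferential.ideal k A) := by
  obtain ⟨⟨x, s⟩, hxs⟩ := IsLocalization.surj M b
  obtain ⟨v, hv⟩ := (hM s s.2).exists_left_inv
  refine ⟨v * Algebra.TensorProduct.lmul' k x, ?_⟩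
  refine (Ideal.unit_mul_mem_iff_mem _ (IsLocalization.map_units B s)).mp ?_
  rw [mul_sub, mul_comm _ b, hxs, ← map_mul, ← map_sub]
  refine Ideal.mem_map_of_mem _ ?_
  rw [KaehlerDifferential.ideal, RingHom.mem_ker, map_sub, map_mul,
    Algebra.TensorProduct.lmul'_apply_tmul, mul_one, ← mul_assoc,
    mul_comm _ v, hv, one_mul, sub_self]

end Diagonal

variable (k)

/-!
STATEMENT 4.
Let `k` be a perfect field and `k[z₁, …, z_d] → A` an étale ring homomorphism from a
polynomial ring (étale = formally étale and of finite presentation).  Let `S ⊆ A⊗_k A` be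
a multiplicative set with `μ(S) ⊆ A^×` and `B = S^{-1}(A⊗_k A)`, and assume the diagonal
ideal `I·B` is generated by the regular sequence `θ₁, …, θ_d` in `B`, where
`θ_i = 1⊗z_i − z_i⊗1`.  Let `j ≥ 1` and `β ∈ Ω^j_A`.  Then there exist
`γ₁, …, γ_d ∈ Ω^{j-1}_A` and `δ₁, …, δ_d ∈ Ω^j_A` with
`p₂^*(β) − p₁^*(β) ≡ Σ_{i=1}^d p₁^*(γ_i) ∧ dθ_i + θ_i·p₁^*(δ_i)` modulo `(J·J)^j` in
`Ω^j_B`; and for any such `γ_i, δ_i` one has: `β = 0` iff `γ_i = 0` for all `i`.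

Here `Ω^j` is the degree-`j` part of the exterior algebra of Kähler differentials
(`OmegaPow`), `(J·J)^j` is built (`JJdeg`) from the extended diagonal ideal `I·B`, and
`p₁^*, p₂^*` are the maps induced on forms by `a ↦ a⊗1` and `a ↦ 1⊗a` into `B`,
characterized by `IsPullback`.
-/
theorem stmt4 [PerfectField k] (d : ℕ) (A : Type) [CommRing A] [Algebra k A]
    [Algebra (MvPolynomial (Fin d) k) A] [IsScalarTower k (MvPolynomial (Fin d) k) A]
    [Algebra.FormallyEtale (MvPolynomial (Fin d) k) A]
    [Algebra.FinitePresentation (MvPolynomial (Fin d) k) A]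
    (M : Submonoid (A ⊗[k] A))
    (hM : ∀ x ∈ M, IsUnit ((Algebra.TensorProduct.lmul' k (S := A) : A ⊗[k] A →ₐ[k] A) x))
    (B : Type) [CommRing B] [Algebra (A ⊗[k] A) B] [IsLocalization M B]
    [Algebra k B] [IsScalarTower k (A ⊗[k] A) B]
    (θ : Fin d → B)
    (hθ : ∀ i, θ i = algebraMap (A ⊗[k] A) B
      ((1 : A) ⊗ₜ[k] (algebraMap (MvPolynomial (Fin d) k) A (MvPolynomial.X i)) -
        (algebraMap (MvPolynomial (Fin d) k) A (MvPolynomial.X i)) ⊗ₜ[k] (1 : A)))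
    (hreg : IsRegSeq θ)
    (hgen : Ideal.map (algebraMap (A ⊗[k] A) B) (KaehlerDifferential.ideal k A) =
      Ideal.span (Set.range θ))
    (p1 p2 : ExteriorAlgebra A (KaehlerDifferential k A) →+*
      ExteriorAlgebra B (KaehlerDifferential k B))
    (hp1 : IsPullback k A B
      ((algebraMap (A ⊗[k] A) B).comp
        (Algebra.TensorProduct.includeLeftRingHom : A →+* A ⊗[k] A)) p1)
    (hp2 : IsPullback k A B
      ((algebraMap (A ⊗[k] A) B).comp
        ((Algebra.TensorProduct.includeRight : A →ₐ[k] A ⊗[k] A) : A →+* A ⊗[k] A)) p2)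
    (j : ℕ) (hj : 1 ≤ j)
    (β : ExteriorAlgebra A (KaehlerDifferential k A)) (hβ : β ∈ OmegaPow k A j) :
    (∃ γ δ : Fin d → ExteriorAlgebra A (KaehlerDifferential k A),
      (∀ i, γ i ∈ OmegaPow k A (j - 1)) ∧ (∀ i, δ i ∈ OmegaPow k A j) ∧
      (p2 β - p1 β) - ∑ i, (p1 (γ i) * dE k B (θ i) + θ i • p1 (δ i)) ∈
        JJdeg k B (Ideal.map (algebraMap (A ⊗[k] A) B) (KaehlerDifferential.ideal k A)) j) ∧
    ∀ γ δ : Fin d → ExteriorAlgebra A (KaehlerDifferential k A),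
      (∀ i, γ i ∈ OmegaPow k A (j - 1)) → (∀ i, δ i ∈ OmegaPow k A j) →
      (p2 β - p1 β) - ∑ i, (p1 (γ i) * dE k B (θ i) + θ i • p1 (δ i)) ∈
        JJdeg k B (Ideal.map (algebraMap (A ⊗[k] A) B) (KaehlerDifferential.ideal k A)) j →
      (β = 0 ↔ ∀ i, γ i = 0) := by
  set I := Ideal.map (algebraMap (A ⊗[k] A) B) (KaehlerDifferential.ideal k A) with hI
  have hφ : ∀ a : A, algebraMap (A ⊗[k] A) B (1 ⊗ₜ a) - algebraMap (A ⊗[k] A) B (a ⊗ₜ 1) ∈ I :=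
    fun a ↦ by
      rw [← map_sub]
      exact Ideal.mem_map_of_mem _ (KaehlerDifferential.one_smul_sub_smul_one_mem_ideal k a)
  refine ⟨?_, fun γ δ hγ hδ h ↦ ?_⟩
  · obtain ⟨γ, δ, ⟨hγ, -⟩, hδ, h⟩ := hp1.exists_expansion hgen hp2 hφ
      (exists_sub_mem_map_ideal M hM) j β hβ
    exact ⟨γ, δ, hγ, hδ, h⟩
  · obtain ⟨c, hc, hcz⟩ := exists_kaehlerDifferential_coord (k := k) d A
    have key : ∀ i, ExteriorAlgebra.map (LinearMap.prod LinearMap.id (c i)) β -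
        ExteriorAlgebra.map (LinearMap.inl A (KaehlerDifferential k A) A) β =
        ExteriorAlgebra.map (LinearMap.inl A (KaehlerDifferential k A) A) (γ i) *
          ExteriorAlgebra.ι A (0, 1) := by
      intro i
      obtain ⟨G, hG₁, hG₂, hG⟩ := exists_ringHom_trivSqZeroExt (B := B) M hM (c i)
      have hGI : I ≤ RingHom.ker ((TrivSqZeroExt.fstHom A A A).toRingHom.comp G) := by
        rw [hI, Ideal.map_le_iff_le_comap]
        intro x hx
        exact (hG x).trans hx
      have hθ' : ∀ l, θ l = algebraMap (A ⊗[k] A) B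
            (1 ⊗ₜ algebraMap (MvPolynomial (Fin d) k) A (MvPolynomial.X l)) -
          algebraMap (A ⊗[k] A) B
            (algebraMap (MvPolynomial (Fin d) k) A (MvPolynomial.X l) ⊗ₜ 1) := fun l ↦ by
        rw [hθ, map_sub]
      simp only [hθ'] at h
      refine hp1.map_sub_map_eq hp2 (fun r ↦ ?_) (c i) G hG₁ hG₂ (fun b hb ↦ hGI hb) _ i
        (hcz i) (fun l ↦ hφ _) h
      exact (IsScalarTower.algebraMap_apply k (A ⊗[k] A) B r).symm
    constructor
    · rintro rfl i
      refine eq_zero_of_map_inl_mul_ι_inr ?_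
      rw [← key i, map_zero, map_zero, sub_zero]
    · intro hγ0
      have hfix : ∀ i, ExteriorAlgebra.map (LinearMap.id - (c i).smulRight
          (KaehlerDifferential.D k A
            (algebraMap (MvPolynomial (Fin d) k) A (MvPolynomial.X i)))) β = β := by
        intro i
        have hi := key i
        rw [hγ0 i, map_zero, zero_mul, sub_eq_zero] at hi
        have hi' := congrArg (ExteriorAlgebra.map (LinearMap.coprod LinearMap.id
          (-(LinearMap.toSpanSingleton A _ (KaehlerDifferential.D k A
            (algebraMap (MvPolynomial (Fin d) k) A (MvPolynomial.X i))))))) hi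
        rw [← AlgHom.comp_apply, ← AlgHom.comp_apply, ExteriorAlgebra.map_comp_map,
          ExteriorAlgebra.map_comp_map, LinearMap.coprod_inl, ExteriorAlgebra.map_id,
          AlgHom.id_apply, LinearMap.coprod_comp_prod] at hi'
        convert hi' using 3
        ext ω
        simp [sub_eq_add_neg]
      have h0 := sub_sum_smul_eq_self c _ hcz hfix Finset.univ
      rw [← h0]
      convert map_zero_eq_zero_of_mem_omegaPow hj hβ using 3
      rw [sub_eq_zero]
      refine LinearMap.ext fun ω ↦ ?_
      simp only [LinearMap.id_apply, LinearMap.sum_apply, LinearMap.smulRight_apply]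
      exact hc ω

end
end

section
/- Let k be a perfect field and k[z₁, …, z_d] → R an étale ring homomorphism, so that Ω¹_R is free with basis dz₁, …, dz_d; for f ∈ R write df = Σ_{i=1}^d (∂f/∂z_i)·dz_i with unique ∂f/∂z_i ∈ R. Let S be a localization of R⊗_k R in which the diagonal ideal is generated by θ₁, …, θ_d, where θ_i = 1⊗z_i − z_i⊗1. Then for every f ∈ R, every j ≥ 1 and all indices 1 ≤ ν₁ < … < ν_j ≤ d, one has in Ω^j_S, modulo (J·J)^j: q₂^*(f·dz_{ν₁} ∧ … ∧ dz_{ν_j}) − q₁^*(f·dz_{ν₁} ∧ … ∧ dz_{ν_j}) ≡ Σ_{s=1}^j (−1)^{j−s} q₁^*(f·dz_{ν₁} ∧ … ∧ d̂z_{ν_s} ∧ … ∧ dz_{ν_j}) ∧ dθ_{ν_s} + Σ_{i=1}^d θ_i · q₁^*((∂f/∂z_i)·dz_{ν₁} ∧ … ∧ dz_{ν_j}), where d̂z_{ν_s} indicates omission of that factor. -/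
set_option maxHeartbeats 1000000
set_option synthInstance.maxHeartbeats 400000

open TensorProduct

noncomputable section

variable (k : Type) [Field k]

section DiagonalIdeal

variable {k} {S : Type} [CommRing S] [Algebra k S] {I : Ideal S}

lemma dE_mem_OmegaPow_one (s : S) : dE k S s ∈ OmegaPow k S 1 := by
  rw [OmegaPow, pow_one]
  exact ⟨_, rfl⟩

lemma mul_mem_OmegaPow {a b : ℕ} {v w : ExteriorAlgebra S (KaehlerDifferential k S)}
    (hv : v ∈ OmegaPow k S a) (hw : w ∈ OmegaPow k S b) : v * w ∈ OmegaPow k S (a + b) := by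
  rw [OmegaPow, pow_add]
  exact Submodule.mul_mem_mul hv hw

lemma one_mem_OmegaPow_zero : (1 : ExteriorAlgebra S (KaehlerDifferential k S)) ∈
    OmegaPow k S 0 := by
  rw [OmegaPow, pow_zero]
  exact Submodule.one_le.mp le_rfl

lemma smul_mem_Jdeg {r : S} (hr : r ∈ I) {j : ℕ}
    {w : ExteriorAlgebra S (KaehlerDifferential k S)} (hw : w ∈ OmegaPow k S j) :
    r • w ∈ Jdeg k S I j := by
  cases j with
  | zero => exact Submodule.smul_mem_smul hr hw
  | succ j => exact Submodule.mem_sup_left (Submodule.smul_mem_smul hr hw)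

lemma dE_mul_mem_Jdeg {r : S} (hr : r ∈ I) {j : ℕ}
    {w : ExteriorAlgebra S (KaehlerDifferential k S)} (hw : w ∈ OmegaPow k S j) :
    dE k S r * w ∈ Jdeg k S I (j + 1) :=
  Submodule.mem_sup_right (Submodule.subset_span ⟨r, hr, w, hw, rfl⟩)

lemma dE_mem_Jdeg_one {r : S} (hr : r ∈ I) : dE k S r ∈ Jdeg k S I 1 := by
  simpa using dE_mul_mem_Jdeg hr (one_mem_OmegaPow_zero (k := k) (S := S))

lemma dE_mul_dE_comm (r s : S) : dE k S r * dE k S s = -(dE k S s * dE k S r) :=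
  eq_neg_of_add_eq_zero_left (ExteriorAlgebra.ι_add_mul_swap _ _)

lemma OmegaPow_mul_dE {j : ℕ} {w : ExteriorAlgebra S (KaehlerDifferential k S)}
    (hw : w ∈ OmegaPow k S j) (r : S) :
    w * dE k S r = (-1 : S) ^ j • (dE k S r * w) := by
  induction hw using Submodule.pow_induction_on_left' with
  | algebraMap s => simp [Algebra.commutes]
  | add x y i _ _ hx hy => rw [add_mul, hx, hy, mul_add, smul_add]
  | mem_mul m hm i x _ hx =>
    obtain ⟨m, rfl⟩ := hm
    have h : ExteriorAlgebra.ι S m * dE k S r = -(dE k S r * ExteriorAlgebra.ι S m) :=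
      eq_neg_of_add_eq_zero_left (ExteriorAlgebra.ι_add_mul_swap _ _)
    rw [mul_assoc, hx, mul_smul_comm, ← mul_assoc, h, pow_succ, mul_smul, neg_one_smul,
      neg_mul, mul_assoc]

lemma mul_dE_mem_Jdeg {r : S} (hr : r ∈ I) {j : ℕ}
    {w : ExteriorAlgebra S (KaehlerDifferential k S)} (hw : w ∈ OmegaPow k S j) :
    w * dE k S r ∈ Jdeg k S I (j + 1) := by
  rw [OmegaPow_mul_dE hw]
  exact Submodule.smul_mem _ _ (dE_mul_mem_Jdeg hr hw)

lemma Jdeg_mul_mem {a b : ℕ} {x w : ExteriorAlgebra S (KaehlerDifferential k S)}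
    (hx : x ∈ Jdeg k S I a) (hw : w ∈ OmegaPow k S b) : x * w ∈ Jdeg k S I (a + b) := by
  have key (n : ℕ) : I • OmegaPow k S n ≤
      (Jdeg k S I (n + b)).comap (LinearMap.mulRight S w) := by
    refine Submodule.smul_le.mpr fun r hr v hv => ?_
    simpa using smul_mem_Jdeg hr (mul_mem_OmegaPow hv hw)
  suffices h : Jdeg k S I a ≤ (Jdeg k S I (a + b)).comap (LinearMap.mulRight S w) from h hx
  cases a with
  | zero => exact key 0
  | succ a =>
    refine sup_le (key _) (Submodule.span_le.mpr ?_)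
    rintro _ ⟨r, hr, v, hv, rfl⟩
    have := dE_mul_mem_Jdeg hr (mul_mem_OmegaPow hv hw)
    rw [← mul_assoc, add_right_comm] at this
    exact this

lemma mul_mem_JJdeg {a b : ℕ} {x y : ExteriorAlgebra S (KaehlerDifferential k S)}
    (hx : x ∈ Jdeg k S I a) (hy : y ∈ Jdeg k S I b) : x * y ∈ JJdeg k S I (a + b) :=
  Submodule.mem_iSup_of_mem ⟨(a, b), rfl⟩ (Submodule.subset_span ⟨x, hx, y, hy, rfl⟩)

lemma JJdeg_mul_mem {a b : ℕ} {x w : ExteriorAlgebra S (KaehlerDifferential k S)}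
    (hx : x ∈ JJdeg k S I a) (hw : w ∈ OmegaPow k S b) : x * w ∈ JJdeg k S I (a + b) := by
  suffices h : JJdeg k S I a ≤ (JJdeg k S I (a + b)).comap (LinearMap.mulRight S w) from h hx
  refine iSup_le ?_
  rintro ⟨⟨m, n⟩, rfl⟩
  refine Submodule.span_le.mpr ?_
  rintro _ ⟨y, hy, v, hv, rfl⟩
  have := mul_mem_JJdeg hy (Jdeg_mul_mem hv hw)
  rw [← mul_assoc, ← add_assoc] at this
  exact this

lemma smul_mem_JJdeg {r : S} (hr : r ∈ I) {j : ℕ}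
    {x : ExteriorAlgebra S (KaehlerDifferential k S)} (hx : x ∈ Jdeg k S I j) :
    r • x ∈ JJdeg k S I j := by
  simpa using mul_mem_JJdeg (smul_mem_Jdeg hr (one_mem_OmegaPow_zero (k := k) (S := S))) hx

lemma sq_smul_mem_JJdeg {r : S} (hr : r ∈ I ^ 2) {j : ℕ}
    {w : ExteriorAlgebra S (KaehlerDifferential k S)} (hw : w ∈ OmegaPow k S j) :
    r • w ∈ JJdeg k S I j := by
  rw [pow_two] at hr
  induction hr using Submodule.mul_induction_on' with
  | mem_mul_mem m hm n hn =>
    rw [mul_smul]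
    exact smul_mem_JJdeg hm (smul_mem_Jdeg hn hw)
  | add x _ y _ hx hy =>
    rw [add_smul]
    exact add_mem hx hy

lemma prod_ofFn_dE_mem_OmegaPow {j : ℕ} (a : Fin j → S) :
    (List.ofFn fun s => dE k S (a s)).prod ∈ OmegaPow k S j := by
  induction j with
  | zero => simpa using one_mem_OmegaPow_zero
  | succ j ih =>
    rw [List.ofFn_succ', List.concat_eq_append, List.prod_append, List.prod_singleton]
    exact mul_mem_OmegaPow (ih _) (dE_mem_OmegaPow_one _)

lemma prod_ofFn_dE_add_sub_mem_Jdeg {j : ℕ} (a b : Fin j → S) (hb : ∀ s, b s ∈ I) :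
    (List.ofFn fun s => dE k S (a s + b s)).prod - (List.ofFn fun s => dE k S (a s)).prod ∈
      Jdeg k S I j := by
  induction j with
  | zero => simp
  | succ j ih =>
    simp only [List.ofFn_succ', List.concat_eq_append, List.prod_append, List.prod_singleton]
    have h₁ := Jdeg_mul_mem (ih (fun s => a s.castSucc) (fun s => b s.castSucc) fun s => hb _)
      (dE_mem_OmegaPow_one (k := k) (a (Fin.last j) + b (Fin.last j)))
    have h₂ := mul_dE_mem_Jdeg (hb (Fin.last j))
      (prod_ofFn_dE_mem_OmegaPow (k := k) fun s : Fin j => a s.castSucc)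
    have hd : dE k S (a (Fin.last j) + b (Fin.last j)) =
      dE k S (a (Fin.last j)) + dE k S (b (Fin.last j)) := by simp [dE]
    convert add_mem h₁ h₂ using 1
    rw [hd]
    noncomm_ring

/-- First-order expansion of `d(a₁ + b₁) ∧ ⋯ ∧ d(aⱼ + bⱼ)` in the `d bₛ`, modulo the square of
the differential graded ideal generated by an ideal containing the `bₛ`. -/
lemma prod_ofFn_dE_add_sub_sub_mem_JJdeg {j : ℕ} (a b : Fin j → S) (hb : ∀ s, b s ∈ I) :
    (List.ofFn fun s => dE k S (a s + b s)).prod - (List.ofFn fun s => dE k S (a s)).prod -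
      ∑ s : Fin j, (-1 : ℤ) ^ (j - 1 - (s : ℕ)) •
        (((List.ofFn fun r => dE k S (a r)).eraseIdx s).prod * dE k S (b s)) ∈
      JJdeg k S I j := by
  induction j with
  | zero => simp
  | succ j ih =>
    have hs (s : Fin j) :
        (-1 : ℤ) ^ (j + 1 - 1 - (s.castSucc : ℕ)) •
          (((List.ofFn fun r => dE k S (a r)).eraseIdx s.castSucc).prod *
            dE k S (b s.castSucc)) =
        (-1 : ℤ) ^ (j - 1 - (s : ℕ)) •
          (((List.ofFn fun r : Fin j => dE k S (a r.castSucc)).eraseIdx s).prod *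
            dE k S (b s.castSucc)) * dE k S (a (Fin.last j)) := by
      have hj : j + 1 - 1 - (s : ℕ) = (j - 1 - (s : ℕ)) + 1 := by omega
      rw [List.ofFn_succ', List.concat_eq_append, Fin.val_castSucc,
        List.eraseIdx_append_of_lt_length (by simp), List.prod_append, List.prod_singleton,
        hj, pow_succ, mul_neg_one, neg_smul, ← smul_neg, smul_mul_assoc, mul_assoc, mul_assoc,
        dE_mul_dE_comm (a _), mul_neg, neg_neg]
    have hl : ((List.ofFn fun r => dE k S (a r)).eraseIdx (Fin.last j)).prod =
        (List.ofFn fun r : Fin j => dE k S (a r.castSucc)).prod := by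
      rw [List.ofFn_succ', List.concat_eq_append, List.eraseIdx_append_of_length_le (by simp)]
      simp
    rw [Fin.sum_univ_castSucc, Finset.sum_congr rfl fun s _ => hs s, ← Finset.sum_mul, hl]
    simp only [List.ofFn_succ', List.concat_eq_append, List.prod_append, List.prod_singleton]
    have h₁ := JJdeg_mul_mem (ih (fun s => a s.castSucc) (fun s => b s.castSucc) fun s => hb _)
      (dE_mem_OmegaPow_one (k := k) (a (Fin.last j)))
    have h₂ := mul_mem_JJdeg (prod_ofFn_dE_add_sub_mem_Jdeg (k := k) (fun s => a s.castSucc)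
      (fun s => b s.castSucc) fun s => hb _) (dE_mem_Jdeg_one (k := k) (hb (Fin.last j)))
    have hd : dE k S (a (Fin.last j) + b (Fin.last j)) =
      dE k S (a (Fin.last j)) + dE k S (b (Fin.last j)) := by simp [dE]
    convert add_mem h₁ h₂ using 1
    simp only [hd, Fin.val_last, Nat.add_sub_cancel, Nat.sub_self, pow_zero, one_smul]
    noncomm_ring

end DiagonalIdeal

/-- First-order Taylor expansion of `f` along the diagonal. -/
lemma one_tmul_sub_tmul_one_sub_sum_mem_sq {R ι : Type} [CommRing R] [Algebra k R] [Fintype ι]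
    (z Df : ι → R) (f : R)
    (hDf : KaehlerDifferential.D k R f = ∑ i, Df i • KaehlerDifferential.D k R (z i)) :
    ((1 : R) ⊗ₜ[k] f - f ⊗ₜ[k] (1 : R)) -
      ∑ i, (Df i ⊗ₜ[k] (1 : R)) * ((1 : R) ⊗ₜ[k] z i - z i ⊗ₜ[k] (1 : R)) ∈
      KaehlerDifferential.ideal k R ^ 2 := by
  have hsmul (r s : R) : r • KaehlerDifferential.D k R s =
      (KaehlerDifferential.ideal k R).toCotangent ((r ⊗ₜ[k] (1 : R)) •
        ⟨_, KaehlerDifferential.one_smul_sub_smul_one_mem_ideal k s⟩) := by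
    rw [map_smul]
    exact (algebraMap_smul (R ⊗[k] R) r (KaehlerDifferential.D k R s)).symm
  simp_rw [hsmul, KaehlerDifferential.D_apply] at hDf
  replace hDf := hDf.trans (map_sum (KaehlerDifferential.ideal k R).toCotangent _ _).symm
  simpa using (Ideal.toCotangent_eq _).mp hDf

/-!
STATEMENT 6.
Let `k` be a perfect field and `k[z₁, …, z_d] → R` an étale ring homomorphism (étale =
formally étale and of finite presentation), so that `Ω¹_R` is free with basis
`dz₁, …, dz_d`; for `f ∈ R` write `df = Σ_i (∂f/∂z_i)·dz_i` with unique `∂f/∂z_i ∈ R`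
(we quantify over any family `Df` of such coefficients; by freeness it is unique).
Let `S` be a localization of `R ⊗_k R` in which the diagonal ideal is generated by
`θ₁, …, θ_d`, where `θ_i = 1⊗z_i − z_i⊗1`.  Then for every `f ∈ R`, every `j ≥ 1` and all
indices `1 ≤ ν₁ < … < ν_j ≤ d`, one has in `Ω^j_S`, modulo `(J·J)^j`:
`q₂^*(f·dz_{ν₁}∧…∧dz_{ν_j}) − q₁^*(f·dz_{ν₁}∧…∧dz_{ν_j})
  ≡ Σ_{s=1}^j (−1)^{j−s} q₁^*(f·dz_{ν₁}∧…∧d̂z_{ν_s}∧…∧dz_{ν_j}) ∧ dθ_{ν_s}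
    + Σ_{i=1}^d θ_i · q₁^*((∂f/∂z_i)·dz_{ν₁}∧…∧dz_{ν_j})`.

Here the pullbacks `q₁^*, q₂^*` of the explicit forms are written out explicitly:
`q_i^*(g·dz_{μ₁}∧…∧dz_{μ_m}) = q_i(g) • d(q_i z_{μ₁})∧…∧d(q_i z_{μ_m})` where
`q₁(r) = r⊗1` and `q₂(r) = 1⊗r` composed with `R⊗_k R → S`; `(J·J)^j` (`JJdeg`) is built
from the ideal of `S` generated by the image of the diagonal ideal.
-/
theorem stmt6 [PerfectField k] (d : ℕ) (R : Type) [CommRing R] [Algebra k R]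
    [Algebra (MvPolynomial (Fin d) k) R] [IsScalarTower k (MvPolynomial (Fin d) k) R]
    [Algebra.FormallyEtale (MvPolynomial (Fin d) k) R]
    [Algebra.FinitePresentation (MvPolynomial (Fin d) k) R]
    (M : Submonoid (R ⊗[k] R))
    (S : Type) [CommRing S] [Algebra (R ⊗[k] R) S] [IsLocalization M S]
    [Algebra k S] [IsScalarTower k (R ⊗[k] R) S]
    (z : Fin d → R)
    (hz : ∀ i, z i = algebraMap (MvPolynomial (Fin d) k) R (MvPolynomial.X i))
    (θ : Fin d → S)
    (hθ : ∀ i, θ i = algebraMap (R ⊗[k] R) S ((1 : R) ⊗ₜ[k] z i - z i ⊗ₜ[k] (1 : R)))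
    (hgen : Ideal.map (algebraMap (R ⊗[k] R) S) (KaehlerDifferential.ideal k R) =
      Ideal.span (Set.range θ))
    (f : R) (Df : Fin d → R)
    (hDf : KaehlerDifferential.D k R f = ∑ i, Df i • KaehlerDifferential.D k R (z i))
    (j : ℕ) (hj : 1 ≤ j) (ν : Fin j → Fin d) (hν : StrictMono ν) :
    ((algebraMap (R ⊗[k] R) S ((1 : R) ⊗ₜ[k] f)) •
        (List.ofFn fun s : Fin j =>
          dE k S (algebraMap (R ⊗[k] R) S ((1 : R) ⊗ₜ[k] z (ν s)))).prod -
      (algebraMap (R ⊗[k] R) S (f ⊗ₜ[k] (1 : R))) •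
        (List.ofFn fun s : Fin j =>
          dE k S (algebraMap (R ⊗[k] R) S (z (ν s) ⊗ₜ[k] (1 : R)))).prod) -
    ((∑ s : Fin j, ((-1 : ℤ) ^ (j - 1 - (s : ℕ))) •
        ((algebraMap (R ⊗[k] R) S (f ⊗ₜ[k] (1 : R))) •
          ((List.ofFn fun r : Fin j =>
            dE k S (algebraMap (R ⊗[k] R) S (z (ν r) ⊗ₜ[k] (1 : R)))).eraseIdx
              (s : ℕ)).prod *
          dE k S (θ (ν s))) +
      ∑ i : Fin d, θ i •
        ((algebraMap (R ⊗[k] R) S (Df i ⊗ₜ[k] (1 : R))) •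
          (List.ofFn fun s : Fin j =>
            dE k S (algebraMap (R ⊗[k] R) S (z (ν s) ⊗ₜ[k] (1 : R)))).prod))) ∈
    JJdeg k S (Ideal.map (algebraMap (R ⊗[k] R) S) (KaehlerDifferential.ideal k R)) j := by
  set q := algebraMap (R ⊗[k] R) S
  set I := Ideal.map q (KaehlerDifferential.ideal k R)
  have hmem (r : R) : q ((1 : R) ⊗ₜ[k] r) - q (r ⊗ₜ[k] (1 : R)) ∈ I := by
    rw [← map_sub]
    exact Ideal.mem_map_of_mem _ (KaehlerDifferential.one_smul_sub_smul_one_mem_ideal k r)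
  have hθI (s : Fin j) : θ (ν s) ∈ I := by
    rw [hθ, map_sub]
    exact hmem _
  have hz₂ (s : Fin j) : q ((1 : R) ⊗ₜ[k] z (ν s)) = q (z (ν s) ⊗ₜ[k] (1 : R)) + θ (ν s) := by
    rw [hθ, map_sub, add_sub_cancel]
  have hsq : q ((1 : R) ⊗ₜ[k] f) - q (f ⊗ₜ[k] (1 : R)) -
      ∑ i, θ i * q (Df i ⊗ₜ[k] (1 : R)) ∈ I ^ 2 := by
    have := Ideal.mem_map_of_mem q (one_tmul_sub_tmul_one_sub_sum_mem_sq k z Df f hDf)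
    rw [Ideal.map_pow, map_sub, map_sub, map_sum] at this
    simpa only [map_mul, ← hθ, mul_comm] using this
  have h₁ := Submodule.smul_mem _ (q (f ⊗ₜ[k] (1 : R)))
    (prod_ofFn_dE_add_sub_sub_mem_JJdeg (k := k) (fun s => q (z (ν s) ⊗ₜ[k] (1 : R)))
      (fun s => θ (ν s)) hθI)
  have h₂ := smul_mem_JJdeg (hmem f)
    (prod_ofFn_dE_add_sub_mem_Jdeg (k := k) (fun s => q (z (ν s) ⊗ₜ[k] (1 : R)))
      (fun s => θ (ν s)) hθI)
  have h₃ := sq_smul_mem_JJdeg hsq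
    (prod_ofFn_dE_mem_OmegaPow (k := k) fun s => q (z (ν s) ⊗ₜ[k] (1 : R)))
  convert add_mem (add_mem h₁ h₂) h₃ using 1
  simp only [hz₂, smul_smul, ← Finset.sum_smul, smul_sub, sub_smul, Finset.smul_sum,
    smul_mul_assoc, smul_comm (q (f ⊗ₜ[k] (1 : R))) ((-1 : ℤ) ^ _)]
  abel

end
end

section
/- Let k be a field, R a commutative k-algebra, and j ≥ 1. The additive map Ω^j_R ⊕ Ω^{j-1}_R → Ω^j_{R[x]} sending (β, α) to x·ῑ(β + dα) + (−1)^{j-1} ῑ(α) ∧ dx is injective, where R[x] is the polynomial ring in one variable, ι: R → R[x] is the inclusion, and ῑ denotes the induced maps on differential forms. -/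
set_option maxHeartbeats 1000000
set_option synthInstance.maxHeartbeats 400000

open TensorProduct

noncomputable section

variable (k : Type) [Field k]

/-- `D'` is the de Rham differential on `Ω^•_{R/k}` (realized inside the exterior algebra
of `Ω¹_{R/k}`): an additive map satisfying
`D'(r·ds₁∧…∧ds_m) = dr∧ds₁∧…∧ds_m` for all `r, s₁, …, s_m ∈ R`.
Such elements additively span the exterior algebra, so this characterizes `D'` uniquely,
and the (existing) de Rham differential satisfies it. -/
def IsDeRhamD (R : Type) [CommRing R] [Algebra k R]
    (D' : ExteriorAlgebra R (KaehlerDifferential k R) →+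
      ExteriorAlgebra R (KaehlerDifferential k R)) : Prop :=
  ∀ (r : R) (l : List R),
    D' (algebraMap R (ExteriorAlgebra R (KaehlerDifferential k R)) r *
        (l.map (dE k R)).prod) =
      dE k R r * (l.map (dE k R)).prod

variable {k} in
/-- Pullback of differential forms along a left inverse of `φ` is a left inverse of pullback
along `φ`. -/
theorem IsPullback.leftInverse {S T : Type} [CommRing S] [CommRing T] [Algebra k S] [Algebra k T]
    {φ : S →+* T} {ψ : T →+* S} (hψφ : Function.LeftInverse ψ φ)
    {P : ExteriorAlgebra S (KaehlerDifferential k S) →+*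
      ExteriorAlgebra T (KaehlerDifferential k T)}
    {Q : ExteriorAlgebra T (KaehlerDifferential k T) →+*
      ExteriorAlgebra S (KaehlerDifferential k S)}
    (hP : IsPullback k S T φ P) (hQ : IsPullback k T S ψ Q) : Function.LeftInverse Q P := by
  have hscalar (s : S) : Q (P (algebraMap S _ s)) = algebraMap S _ s := by
    rw [hP.1, hQ.1, hψφ]
  have hι (m : KaehlerDifferential k S) :
      Q (P (ExteriorAlgebra.ι S m)) = ExteriorAlgebra.ι S m := by
    have hm : m ∈ Submodule.span S (Set.range (KaehlerDifferential.D k S)) := by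
      rw [KaehlerDifferential.span_range_derivation]; trivial
    induction hm using Submodule.span_induction with
    | mem x hx =>
      obtain ⟨s, rfl⟩ := hx
      change Q (P (dE k S s)) = dE k S s
      rw [hP.2, hQ.2, hψφ]
    | zero => simp
    | add x y _ _ hx hy => simp only [map_add, hx, hy]
    | smul s x _ hx => rw [map_smul, Algebra.smul_def, map_mul, map_mul, hx, hscalar]
  intro z
  induction z using ExteriorAlgebra.induction with
  | algebraMap s => exact hscalar s
  | ι m => exact hι m
  | mul a b ha hb => rw [map_mul, map_mul, ha, hb]
  | add a b ha hb => rw [map_add, map_add, ha, hb]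

/-- The pullback of differential forms along an algebra map exists. -/
theorem exists_isPullback (S T : Type) [CommRing S] [CommRing T] [Algebra k S] [Algebra k T]
    [Algebra S T] [IsScalarTower k S T] :
    ∃ P : ExteriorAlgebra S (KaehlerDifferential k S) →+*
      ExteriorAlgebra T (KaehlerDifferential k T), IsPullback k S T (algebraMap S T) P := by
  let f : KaehlerDifferential k S →ₗ[S] ExteriorAlgebra T (KaehlerDifferential k T) :=
    (ExteriorAlgebra.ι T).restrictScalars S ∘ₗ KaehlerDifferential.map k k S T
  have hf (m : KaehlerDifferential k S) : f m * f m = 0 := ExteriorAlgebra.ι_sq_zero _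
  refine ⟨(ExteriorAlgebra.lift S ⟨f, hf⟩).toRingHom, fun s => ?_, fun s => ?_⟩
  · refine (AlgHom.commutes _ s).trans ?_
    exact IsScalarTower.algebraMap_apply S T _ s
  · refine (ExteriorAlgebra.lift_ι_apply S f hf _).trans ?_
    simp only [f, dE, LinearMap.comp_apply, LinearMap.restrictScalars_apply,
      KaehlerDifferential.map_D]

variable {k} in
/-- Contraction with a linear form on `Ω¹_{T/k}` that vanishes on the differentials of the
image of `S` kills every form pulled back from `S`. -/
theorem IsPullback.contractRight_eq_zero {S T : Type} [CommRing S] [CommRing T]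
    [Algebra k S] [Algebra k T] {φ : S →+* T}
    {P : ExteriorAlgebra S (KaehlerDifferential k S) →+*
      ExteriorAlgebra T (KaehlerDifferential k T)}
    (hP : IsPullback k S T φ P) (f : Module.Dual T (KaehlerDifferential k T))
    (hf : ∀ s, f (KaehlerDifferential.D k T (φ s)) = 0)
    (z : ExteriorAlgebra S (KaehlerDifferential k S)) :
    CliffordAlgebra.contractRight (P z) f = 0 := by
  have hι (m : KaehlerDifferential k S) :
      ∃ n, P (ExteriorAlgebra.ι S m) = ExteriorAlgebra.ι T n ∧ f n = 0 := by
    have hm : m ∈ Submodule.span S (Set.range (KaehlerDifferential.D k S)) := by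
      rw [KaehlerDifferential.span_range_derivation]; trivial
    induction hm using Submodule.span_induction with
    | mem x hx =>
      obtain ⟨s, rfl⟩ := hx
      exact ⟨_, hP.2 s, hf s⟩
    | zero => exact ⟨0, by simp, map_zero f⟩
    | add x y _ _ hx hy =>
      obtain ⟨a, ha, ha'⟩ := hx
      obtain ⟨b, hb, hb'⟩ := hy
      exact ⟨a + b, by simp only [map_add, ha, hb], by rw [map_add, ha', hb', add_zero]⟩
    | smul s x _ hx =>
      obtain ⟨a, ha, ha'⟩ := hx
      refine ⟨φ s • a, ?_, by rw [map_smul, ha', smul_zero]⟩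
      rw [map_smul, Algebra.smul_def, map_mul, ha, hP.1, map_smul, Algebra.smul_def]
  induction z using CliffordAlgebra.right_induction with
  | algebraMap s =>
    exact (congrArg (CliffordAlgebra.contractRight · f) (hP.1 s)).trans
      (CliffordAlgebra.contractRight_algebraMap _ _ _)
  | add a b ha hb => rw [map_add, map_add, LinearMap.add_apply, ha, hb, add_zero]
  | mul_ι m a ha =>
    obtain ⟨n, hn, hn'⟩ := hι m
    have hmul : P (a * CliffordAlgebra.ι 0 m) = P a * CliffordAlgebra.ι 0 n :=
      (map_mul P _ _).trans (congrArg (P a * ·) hn)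
    rw [hmul, CliffordAlgebra.contractRight_mul_ι, ha, hn', zero_smul, zero_mul, sub_zero]

/-- Evaluation at `1` induces a map on differential forms. -/
theorem exists_isPullback_eval_one (R : Type) [CommRing R] [Algebra k R] :
    ∃ Q : ExteriorAlgebra (Polynomial R) (KaehlerDifferential k (Polynomial R)) →+*
      ExteriorAlgebra R (KaehlerDifferential k R),
      IsPullback k (Polynomial R) R (Polynomial.evalRingHom 1) Q := by
  let : Algebra (Polynomial R) R := (Polynomial.evalRingHom (1 : R)).toAlgebra
  have : IsScalarTower k (Polynomial R) R := IsScalarTower.of_algebraMap_eq fun r => by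
    change _ = Polynomial.eval 1 (Polynomial.C (algebraMap k R r))
    rw [Polynomial.eval_C]
  exact exists_isPullback k (Polynomial R) R

/-- The `R[x]`-linear form on `Ω¹_{R[x]/k}` given by contraction with `∂/∂x`. -/
def partialXForm (R : Type) [CommRing R] [Algebra k R] :
    Module.Dual (Polynomial R) (KaehlerDifferential k (Polynomial R)) :=
  (Polynomial.derivative' (R := R)).restrictScalars k |>.liftKaehlerDifferential

theorem partialXForm_D (R : Type) [CommRing R] [Algebra k R] (p : Polynomial R) :
    partialXForm k R (KaehlerDifferential.D k (Polynomial R) p) = Polynomial.derivative p :=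
  Derivation.liftKaehlerDifferential_comp_D _ _

variable {k} in
/-- If the form `x·ῑ(γ) ± ῑ(α) ∧ dx` on `R[x]` vanishes, then so do `γ` and `α`. -/
theorem IsPullback.eq_zero_of_X_smul_add {R : Type} [CommRing R] [Algebra k R]
    {P : ExteriorAlgebra R (KaehlerDifferential k R) →+*
      ExteriorAlgebra (Polynomial R) (KaehlerDifferential k (Polynomial R))}
    (hP : IsPullback k R (Polynomial R) (Polynomial.C : R →+* Polynomial R) P) (n : ℕ)
    {γ α : ExteriorAlgebra R (KaehlerDifferential k R)}
    (h : (Polynomial.X : Polynomial R) • P γ +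
      ((-1 : ℤ) ^ n) • (P α * dE k (Polynomial R) Polynomial.X) = 0) :
    γ = 0 ∧ α = 0 := by
  obtain ⟨Q, hQ⟩ := exists_isPullback_eval_one k R
  have hQP : Function.LeftInverse Q P :=
    hP.leftInverse (fun r => by simp) hQ
  have hγ : γ = 0 := by
    have hdX : Q (dE k (Polynomial R) Polynomial.X) = 0 := by
      rw [hQ.2]; simp [dE]
    have := congrArg Q h
    rw [map_add, map_zsmul, map_mul, hdX, mul_zero, smul_zero, add_zero, Algebra.smul_def,
      map_mul, hQ.1, hQP, map_zero] at this
    simpa using this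
  refine ⟨hγ, ?_⟩
  have hαdX : P α * dE k (Polynomial R) Polynomial.X = 0 := by
    rw [hγ, map_zero, smul_zero, zero_add] at h
    rcases neg_one_pow_eq_or ℤ n with hn | hn <;> rw [hn] at h <;> simpa using h
  have hf (r : R) : partialXForm k R
      (KaehlerDifferential.D k (Polynomial R) (Polynomial.C r)) = 0 := by
    rw [partialXForm_D, Polynomial.derivative_C]
  have hcontr : CliffordAlgebra.contractRight
      (P α * dE k (Polynomial R) Polynomial.X) (partialXForm k R) = P α := by
    refine (CliffordAlgebra.contractRight_mul_ι _ _ _).trans ?_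
    rw [hP.contractRight_eq_zero _ hf, partialXForm_D, Polynomial.derivative_X, one_smul,
      zero_mul, sub_zero]
  have hPα : P α = 0 := by
    rw [← hcontr, hαdX, map_zero, LinearMap.zero_apply]
  rw [← hQP α, hPα, map_zero]

/-!
STATEMENT 7.
Let `k` be a field, `R` a commutative `k`-algebra, and `j ≥ 1`.  The additive map
`Ω^j_R ⊕ Ω^{j-1}_R → Ω^j_{R[x]}` sending `(β, α)` to
`x·ῑ(β + dα) + (−1)^{j-1}·ῑ(α) ∧ dx` is injective, where `R[x]` is the polynomial ring in
one variable, `ι : R → R[x]` is the inclusion, and `ῑ` denotes the induced maps on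
differential forms.

Here `Ω^j` is the degree-`j` part of the exterior algebra of Kähler differentials
(`OmegaPow`), the pullback `ῑ` is characterized by `IsPullback` along `Polynomial.C`, the
de Rham differential `d : Ω^{j-1}_R → Ω^j_R` is characterized by `IsDeRhamD`, and
injectivity is stated on pairs.
-/
theorem stmt7 (R : Type) [CommRing R] [Algebra k R] (j : ℕ) (hj : 1 ≤ j)
    (ιs : ExteriorAlgebra R (KaehlerDifferential k R) →+*
      ExteriorAlgebra (Polynomial R) (KaehlerDifferential k (Polynomial R)))
    (hιs : IsPullback k R (Polynomial R) (Polynomial.C : R →+* Polynomial R) ιs)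
    (D' : ExteriorAlgebra R (KaehlerDifferential k R) →+
      ExteriorAlgebra R (KaehlerDifferential k R))
    (hD' : IsDeRhamD k R D') :
    ∀ (β β' : ExteriorAlgebra R (KaehlerDifferential k R))
      (α α' : ExteriorAlgebra R (KaehlerDifferential k R)),
      β ∈ OmegaPow k R j → β' ∈ OmegaPow k R j →
      α ∈ OmegaPow k R (j - 1) → α' ∈ OmegaPow k R (j - 1) →
      (Polynomial.X : Polynomial R) • ιs (β + D' α) +
          ((-1 : ℤ) ^ (j - 1)) • (ιs α * dE k (Polynomial R) Polynomial.X) =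
        (Polynomial.X : Polynomial R) • ιs (β' + D' α') +
          ((-1 : ℤ) ^ (j - 1)) • (ιs α' * dE k (Polynomial R) Polynomial.X) →
      β = β' ∧ α = α' := by
  intro β β' α α' _ _ _ _ h
  have hdiff : (Polynomial.X : Polynomial R) • ιs ((β - β') + D' (α - α')) +
      ((-1 : ℤ) ^ (j - 1)) • (ιs (α - α') * dE k (Polynomial R) Polynomial.X) = 0 := by
    rw [← sub_eq_zero] at h
    rw [← h]
    simp only [map_add, map_sub, smul_add, smul_sub, sub_mul]
    abel
  obtain ⟨hβ, hα⟩ := hιs.eq_zero_of_X_smul_add _ hdiff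
  rw [hα, map_zero, add_zero] at hβ
  exact ⟨sub_eq_zero.mp hβ, sub_eq_zero.mp hα⟩

end
end
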